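/- arXiv:1711.07454 — 15 statements merged into one kernel-verified Lean document; each statement's English description precedes it below -/
import Mathlib

section
/- Let t ≥ 2 be an even integer, let X₁,…,X_n ∈ ℝ^d, let T ⊆ {1,…,n} be nonempty, and let μ* ∈ ℝ^d. Assume that for every v ∈ ℝ^d, ∑_{i∈T} ⟨μ* − X_i, v⟩^t ≤ 2·|T|·t^{t/2}·‖v‖^t. Let S ⊆ {1,…,n} with S ∩ T ≠ ∅ and |S| ≤ |T|, let μ = (1/|S|)·∑_{i∈S} X_i, and assume that for every u ∈ ℝ^d, ∑_{i∈S} ⟨X_i − μ, u⟩^t ≤ 2·|S|·t^{t/2}·‖u‖^t. Then ‖μ − μ*‖ ≤ 4·t^{1/2}·(|T|/|S∩T|)^{1/t}. -/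
open RealInnerProductSpace Finset

/-- **Identifiability of the mean from overlapping subsets with bounded empirical moments.**
If the samples indexed by `T` have `t`-th moments about `μs` bounded by `2|T|t^{t/2}`,
and `S` is a set of samples with `S ∩ T ≠ ∅`, `|S| ≤ |T|`, whose empirical `t`-th moments
about its empirical mean `μ` are bounded by `2|S|t^{t/2}`, then
`‖μ - μs‖ ≤ 4 √t (|T|/|S ∩ T|)^{1/t}`. -/
theorem stmt_0 {d n : ℕ} (t : ℕ) (ht2 : 2 ≤ t) (hte : Even t)
    (X : Fin n → EuclideanSpace ℝ (Fin d))
    (T : Finset (Fin n)) (hT : T.Nonempty)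
    (μs : EuclideanSpace ℝ (Fin d))
    (hTmom : ∀ v : EuclideanSpace ℝ (Fin d),
      ∑ i ∈ T, ⟪μs - X i, v⟫ ^ t ≤ 2 * (T.card : ℝ) * (t : ℝ) ^ (t / 2) * ‖v‖ ^ t)
    (S : Finset (Fin n)) (hST : (S ∩ T).Nonempty) (hcard : S.card ≤ T.card)
    (μ : EuclideanSpace ℝ (Fin d))
    (hμ : μ = ((S.card : ℝ))⁻¹ • ∑ i ∈ S, X i)
    (hSmom : ∀ u : EuclideanSpace ℝ (Fin d),
      ∑ i ∈ S, ⟪X i - μ, u⟫ ^ t ≤ 2 * (S.card : ℝ) * (t : ℝ) ^ (t / 2) * ‖u‖ ^ t) :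
    ‖μ - μs‖ ≤ 4 * (t : ℝ) ^ ((1 : ℝ) / 2) *
      ((T.card : ℝ) / ((S ∩ T).card : ℝ)) ^ ((1 : ℝ) / (t : ℝ)) := by
  have ht0 : t ≠ 0 := by omega
  have hm : (0 : ℝ) < ((S ∩ T).card : ℝ) := by exact_mod_cast hST.card_pos
  have hcard' : (S.card : ℝ) ≤ T.card := by exact_mod_cast hcard
  have hrhs : (4 * (t : ℝ) ^ ((1 : ℝ) / 2) *
      ((T.card : ℝ) / ((S ∩ T).card : ℝ)) ^ ((1 : ℝ) / (t : ℝ))) ^ t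
      = 4 ^ t * (t : ℝ) ^ (t / 2) * ((T.card : ℝ) / ((S ∩ T).card : ℝ)) := by
    have hroot : (((T.card : ℝ) / ((S ∩ T).card : ℝ)) ^ ((1 : ℝ) / (t : ℝ))) ^ t
        = (T.card : ℝ) / ((S ∩ T).card : ℝ) := by
      rw [one_div]
      exact Real.rpow_inv_natCast_pow (by positivity) ht0
    have hsqrt : ((t : ℝ) ^ ((1 : ℝ) / 2)) ^ t = (t : ℝ) ^ (t / 2) := by
      conv_lhs => rw [← Nat.two_mul_div_two_of_even hte]
      rw [pow_mul, ← Real.sqrt_eq_rpow]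
      simp only [Nat.two_mul_div_two_of_even hte]
      rw [Real.sq_sqrt (Nat.cast_nonneg t)]
    rw [mul_pow, mul_pow, hroot, hsqrt]
  refine le_of_pow_le_pow_left₀ ht0 (by positivity) ?_
  rw [hrhs]
  rcases (norm_nonneg (μ - μs)).eq_or_lt with h0 | hpos
  · rw [← h0, zero_pow ht0]
    positivity
  set v := μ - μs with hv
  set C : ℝ := (t : ℝ) ^ (t / 2)
  have hC : 0 ≤ C := by positivity
  have hpoint : ∀ i, (‖v‖ ^ t) * ‖v‖ ^ t
      ≤ 2 ^ (t - 1) * (⟪X i - μ, v⟫ ^ t + ⟪μs - X i, v⟫ ^ t) := by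
    intro i
    have hsum : ⟪X i - μ, v⟫ + ⟪μs - X i, v⟫ = -(‖v‖ * ‖v‖) := by
      rw [← inner_add_left, show X i - μ + (μs - X i) = -v by rw [hv]; abel, inner_neg_left,
        real_inner_self_eq_norm_mul_norm]
    rw [← mul_pow, ← hte.neg_pow, ← hsum]
    exact hte.add_pow_le
  have hSsub : ∑ i ∈ S ∩ T, ⟪X i - μ, v⟫ ^ t ≤ 2 * (T.card : ℝ) * C * ‖v‖ ^ t :=
    calc _ ≤ ∑ i ∈ S, ⟪X i - μ, v⟫ ^ t :=
          sum_le_sum_of_subset_of_nonneg inter_subset_left fun i _ _ => hte.pow_nonneg _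
      _ ≤ 2 * (S.card : ℝ) * C * ‖v‖ ^ t := hSmom v
      _ ≤ _ := by gcongr
  have hTsub : ∑ i ∈ S ∩ T, ⟪μs - X i, v⟫ ^ t ≤ 2 * (T.card : ℝ) * C * ‖v‖ ^ t :=
    (sum_le_sum_of_subset_of_nonneg inter_subset_right fun i _ _ => hte.pow_nonneg _).trans
      (hTmom v)
  have hpow : (2 : ℝ) ^ (t - 1) * 4 ≤ 4 ^ t := by
    calc (2 : ℝ) ^ (t - 1) * 4 ≤ 4 ^ (t - 1) * 4 := by gcongr; norm_num
      _ = 4 ^ t := pow_sub_one_mul ht0 4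
  have htotal : (((S ∩ T).card : ℝ) * ‖v‖ ^ t) * ‖v‖ ^ t
      ≤ (4 ^ t * C * T.card) * ‖v‖ ^ t :=
    calc _ = ∑ i ∈ S ∩ T, (‖v‖ ^ t) * ‖v‖ ^ t := by rw [sum_const, nsmul_eq_mul, mul_assoc]
      _ ≤ ∑ i ∈ S ∩ T, 2 ^ (t - 1) * (⟪X i - μ, v⟫ ^ t + ⟪μs - X i, v⟫ ^ t) :=
          sum_le_sum fun i _ => hpoint i
      _ = 2 ^ (t - 1) * (∑ i ∈ S ∩ T, ⟪X i - μ, v⟫ ^ t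
            + ∑ i ∈ S ∩ T, ⟪μs - X i, v⟫ ^ t) := by rw [← mul_sum, sum_add_distrib]
      _ ≤ 2 ^ (t - 1) * (2 * (T.card : ℝ) * C * ‖v‖ ^ t + 2 * (T.card : ℝ) * C * ‖v‖ ^ t) := by
          gcongr
      _ = (2 ^ (t - 1) * 4) * (C * T.card * ‖v‖ ^ t) := by ring
      _ ≤ 4 ^ t * (C * T.card * ‖v‖ ^ t) := by gcongr
      _ = _ := by ring
  rw [← mul_div_assoc, le_div_iff₀ hm, mul_comm]
  exact le_of_mul_le_mul_right htotal (by positivity)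
end

section
/- There is a universal constant C such that for every n ≥ 1 and every q ≥ 2 that is a power of two the following holds. In the polynomial ring ℝ[w₁,…,w_n,x₁,…,x_n] there exist a sum-of-squares polynomial σ of degree at most C·q and polynomials h₁,…,h_n with deg(h_i·(w_i² − w_i)) ≤ C·q for each i, such that (∑_{i=1}^n w_i)^{q−1}·(∑_{i=1}^n x_i^q) − (∑_{i=1}^n w_i x_i)^q = σ + ∑_{i=1}^n h_i·(w_i² − w_i). -/
open MvPolynomial

/-- `p` is congruent to a sum of squares modulo the Booleanness equations `wᵢ² = wᵢ`, by a
certificate all of whose summands have degree at most `D`. -/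
def HasBooleanSosCert {n : ℕ} (D : ℕ) (p : MvPolynomial (Fin n ⊕ Fin n) ℝ) : Prop :=
  ∃ (σ : MvPolynomial (Fin n ⊕ Fin n) ℝ) (h : Fin n → MvPolynomial (Fin n ⊕ Fin n) ℝ),
    IsSumSq σ ∧ σ.totalDegree ≤ D ∧
    (∀ i : Fin n, (h i * (X (Sum.inl i) ^ 2 - X (Sum.inl i))).totalDegree ≤ D) ∧
    p = σ + ∑ i : Fin n, h i * (X (Sum.inl i) ^ 2 - X (Sum.inl i))

section Degree

variable {τ : Type*} {p q : MvPolynomial τ ℝ} {a b : ℕ}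

theorem totalDegree_mul_le_add (hp : p.totalDegree ≤ a) (hq : q.totalDegree ≤ b) :
    (p * q).totalDegree ≤ a + b :=
  (totalDegree_mul p q).trans (add_le_add hp hq)

theorem totalDegree_pow_le_mul (hp : p.totalDegree ≤ a) (k : ℕ) :
    (p ^ k).totalDegree ≤ k * a :=
  (totalDegree_pow p k).trans (Nat.mul_le_mul_left k hp)

theorem totalDegree_sub_le_of_le (hp : p.totalDegree ≤ a) (hq : q.totalDegree ≤ a) :
    (p - q).totalDegree ≤ a :=
  (totalDegree_sub p q).trans (max_le hp hq)

theorem totalDegree_add_le_of_le (hp : p.totalDegree ≤ a) (hq : q.totalDegree ≤ a) :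
    (p + q).totalDegree ≤ a :=
  (totalDegree_add p q).trans (max_le hp hq)

theorem totalDegree_sum_X_le {n : ℕ} (f : Fin n → τ) :
    (∑ i, (X (f i) : MvPolynomial τ ℝ)).totalDegree ≤ 1 :=
  totalDegree_finsetSum_le fun i _ => (totalDegree_X (R := ℝ) (f i)).le

end Degree

theorem sum_sum_mul_mul_sub_sq {ι R : Type*} [Fintype ι] [CommRing R] (w y : ι → R) :
    ∑ i, ∑ j, w i * w j * (y i - y j) ^ 2 =
      2 * ((∑ i, w i) * (∑ i, w i * y i ^ 2) - (∑ i, w i * y i) ^ 2) := by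
  have h₁ : (∑ i, w i) * (∑ i, w i * y i ^ 2) = ∑ i, ∑ j, w i * (w j * y j ^ 2) :=
    Finset.sum_mul_sum _ _ _ _
  have h₂ : (∑ i, w i) * (∑ i, w i * y i ^ 2) = ∑ i, ∑ j, w i * y i ^ 2 * w j := by
    rw [mul_comm]; exact Finset.sum_mul_sum _ _ _ _
  have h₃ : (∑ i, w i * y i) ^ 2 = ∑ i, ∑ j, w i * y i * (w j * y j) := by
    rw [sq]; exact Finset.sum_mul_sum _ _ _ _
  calc
    _ = (∑ i, ∑ j, w i * (w j * y j ^ 2)) + (∑ i, ∑ j, w i * y i ^ 2 * w j)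
        - 2 * ∑ i, ∑ j, w i * y i * (w j * y j) := by
      simp only [Finset.mul_sum, ← Finset.sum_add_distrib, ← Finset.sum_sub_distrib]
      exact Finset.sum_congr rfl fun i _ => Finset.sum_congr rfl fun j _ => by ring
    _ = _ := by rw [← h₁, ← h₂, ← h₃]; ring

namespace HasBooleanSosCert

variable {n D E : ℕ} {p q r : MvPolynomial (Fin n ⊕ Fin n) ℝ}

theorem mono (hp : HasBooleanSosCert D p) (hDE : D ≤ E) : HasBooleanSosCert E p := by
  obtain ⟨σ, h, hσ, hd, hh, e⟩ := hp
  exact ⟨σ, h, hσ, hd.trans hDE, fun i => (hh i).trans hDE, e⟩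

theorem add (hp : HasBooleanSosCert D p) (hq : HasBooleanSosCert D q) :
    HasBooleanSosCert D (p + q) := by
  obtain ⟨σ, h, hσ, hd, hh, rfl⟩ := hp
  obtain ⟨σ', h', hσ', hd', hh', rfl⟩ := hq
  refine ⟨σ + σ', fun i => h i + h' i, hσ.add hσ', totalDegree_add_le_of_le hd hd',
    fun i => ?_, ?_⟩
  · rw [add_mul]
    exact totalDegree_add_le_of_le (hh i) (hh' i)
  · simp only [add_mul, Finset.sum_add_distrib]
    ring

theorem sq (hr : r.totalDegree ≤ D) : HasBooleanSosCert (2 * D) (r ^ 2) :=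
  ⟨r ^ 2, 0, (IsSquare.sq r).isSumSq, totalDegree_pow_le_mul hr 2, by simp, by simp⟩

theorem zero : HasBooleanSosCert D (0 : MvPolynomial (Fin n ⊕ Fin n) ℝ) :=
  ⟨0, 0, IsSumSq.zero, by simp, by simp, by simp⟩

theorem sum {ι : Type*} (s : Finset ι) (f : ι → MvPolynomial (Fin n ⊕ Fin n) ℝ)
    (hf : ∀ i ∈ s, HasBooleanSosCert D (f i)) : HasBooleanSosCert D (∑ i ∈ s, f i) :=
  Finset.sum_induction f _ (fun _ _ => add) zero hf

theorem sq_mul (hp : HasBooleanSosCert D p) (hr : r.totalDegree ≤ E) :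
    HasBooleanSosCert (2 * E + D) (r ^ 2 * p) := by
  obtain ⟨σ, h, hσ, hd, hh, rfl⟩ := hp
  have hr' := totalDegree_pow_le_mul hr 2
  refine ⟨r ^ 2 * σ, fun i => r ^ 2 * h i, (IsSquare.sq r).isSumSq.mul hσ,
    totalDegree_mul_le_add hr' hd, fun i => ?_, ?_⟩
  · rw [mul_assoc]
    exact totalDegree_mul_le_add hr' (hh i)
  · simp only [mul_add, Finset.mul_sum, mul_assoc]

theorem C_mul (hp : HasBooleanSosCert D p) {c : ℝ} (hc : 0 ≤ c) :
    HasBooleanSosCert D (C c * p) := by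
  have h := sq_mul (r := C (Real.sqrt c)) (E := 0) hp (by simp)
  rw [← C_pow, Real.sq_sqrt hc] at h
  simpa using h

theorem mul_bool (g : MvPolynomial (Fin n ⊕ Fin n) ℝ) (i : Fin n) (hg : g.totalDegree ≤ D) :
    HasBooleanSosCert (D + 2) (g * (X (Sum.inl i) ^ 2 - X (Sum.inl i))) := by
  refine ⟨0, Pi.single i g, IsSumSq.zero, by simp, fun j => ?_, ?_⟩
  · rcases eq_or_ne j i with rfl | hj
    · rw [Pi.single_eq_same]
      refine totalDegree_mul_le_add hg (totalDegree_sub_le_of_le ?_ ?_) <;> simp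
    · simp [Pi.single_eq_of_ne hj]
  · rw [zero_add, Finset.sum_eq_single i]
    · simp
    · intro j _ hj
      simp [Pi.single_eq_of_ne hj]
    · simp

theorem mul_mul_sq {a b : MvPolynomial (Fin n ⊕ Fin n) ℝ} {i j : Fin n}
    (ha : a.totalDegree ≤ 1) (hb : b.totalDegree ≤ 1)
    (hai : a ^ 2 - a = X (Sum.inl i) ^ 2 - X (Sum.inl i))
    (hbj : b ^ 2 - b = X (Sum.inl j) ^ 2 - X (Sum.inl j)) (hr : r.totalDegree ≤ D) :
    HasBooleanSosCert (2 * D + 4) (a * b * r ^ 2) := by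
  have hr2 := totalDegree_pow_le_mul hr 2
  have key : a * b * r ^ 2 = (a * b * r) ^ 2 +
      (-(a ^ 2 * r ^ 2) * (X (Sum.inl j) ^ 2 - X (Sum.inl j)) +
        -(b * r ^ 2) * (X (Sum.inl i) ^ 2 - X (Sum.inl i))) := by
    rw [← hai, ← hbj]; ring
  rw [key]
  refine ((sq (totalDegree_mul_le_add (totalDegree_mul_le_add ha hb) hr)).mono (by omega)).add
    (((mul_bool _ _ (D := 2 * 1 + 2 * D) ?_).mono (by omega)).add
      ((mul_bool _ _ (D := 1 + 2 * D) ?_).mono (by omega)))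
  · rw [totalDegree_neg]
    exact totalDegree_mul_le_add (totalDegree_pow_le_mul ha 2) hr2
  · rw [totalDegree_neg]
    exact totalDegree_mul_le_add hb hr2

/-- The Cauchy–Schwarz inequality for Boolean weights. -/
theorem cauchySchwarz (y : Fin n → MvPolynomial (Fin n ⊕ Fin n) ℝ)
    (hy : ∀ i, (y i).totalDegree ≤ D) :
    HasBooleanSosCert (2 * D + 4)
      ((∑ i, X (Sum.inl i)) * (∑ i, X (Sum.inl i) * y i ^ 2) -
        (∑ i, X (Sum.inl i) * y i) ^ 2) := by
  have h : HasBooleanSosCert (2 * D + 4)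
      (∑ i, ∑ j, X (Sum.inl i) * X (Sum.inl j) * (y i - y j) ^ 2) :=
    sum _ _ fun i _ => sum _ _ fun j _ =>
      mul_mul_sq (totalDegree_X _).le (totalDegree_X _).le rfl rfl
        (totalDegree_sub_le_of_le (hy i) (hy j))
  rw [sum_sum_mul_mul_sub_sq] at h
  have h' := h.C_mul (c := 1 / 2) (by norm_num)
  rwa [← mul_assoc, show (2 : MvPolynomial (Fin n ⊕ Fin n) ℝ) = C 2 from (map_ofNat C 2).symm,
    ← MvPolynomial.C_mul, show (1 / 2 : ℝ) * 2 = 1 by norm_num, C_1, one_mul] at h'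

theorem weighted_holder (k : ℕ) :
    HasBooleanSosCert (4 * 2 ^ (k + 1))
      ((∑ i : Fin n, X (Sum.inl i)) ^ (2 ^ (k + 1) - 1) *
          (∑ i : Fin n, X (Sum.inl i) * X (Sum.inr i) ^ 2 ^ (k + 1)) -
        (∑ i : Fin n, X (Sum.inl i) * X (Sum.inr i)) ^ 2 ^ (k + 1)) := by
  induction k with
  | zero =>
    simpa using (cauchySchwarz (D := 1) (fun i : Fin n => X (Sum.inr i))
      (fun i => (totalDegree_X _).le)).mono (by norm_num : _ ≤ 8)
  | succ k ih =>
    have hQ : (2 : ℕ) ^ (k + 1 + 1) = 2 * 2 ^ (k + 1) := by ring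
    have hm : (2 : ℕ) ^ (k + 1) = 2 * 2 ^ k := by ring
    have hpos : 1 ≤ (2 : ℕ) ^ k := Nat.one_le_two_pow
    rw [hQ]
    generalize hq : (2 : ℕ) ^ (k + 1) = q at *
    generalize (2 : ℕ) ^ k = m at *
    set W : MvPolynomial (Fin n ⊕ Fin n) ℝ := ∑ i, X (Sum.inl i) with hW
    set P : MvPolynomial (Fin n ⊕ Fin n) ℝ := ∑ i, X (Sum.inl i) * X (Sum.inr i) with hP
    set A : MvPolynomial (Fin n ⊕ Fin n) ℝ := ∑ i, X (Sum.inl i) * X (Sum.inr i) ^ q with hA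
    have dX (t : Fin n ⊕ Fin n) : (X t : MvPolynomial (Fin n ⊕ Fin n) ℝ).totalDegree ≤ 1 :=
      (totalDegree_X t).le
    have dW : W.totalDegree ≤ 1 := totalDegree_sum_X_le _
    have dP : P.totalDegree ≤ 1 + 1 :=
      totalDegree_finsetSum_le fun i _ => totalDegree_mul_le_add (dX _) (dX _)
    have dA : A.totalDegree ≤ 1 + q * 1 :=
      totalDegree_finsetSum_le fun i _ =>
        totalDegree_mul_le_add (dX _) (totalDegree_pow_le_mul (dX _) q)
    have dS : (W ^ (q - 1) * A - P ^ q).totalDegree ≤ 2 * q :=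
      totalDegree_sub_le_of_le
        ((totalDegree_mul_le_add (totalDegree_pow_le_mul dW (q - 1)) dA).trans (by omega))
        ((totalDegree_pow_le_mul dP q).trans (by omega))
    have hCS := (cauchySchwarz (fun i : Fin n => X (Sum.inr i) ^ q)
      (fun i => totalDegree_pow_le_mul (dX _) q)).sq_mul (totalDegree_pow_le_mul dW (q - 1))
    have hB := (ih.sq_mul (totalDegree_pow_le_mul dP m)).C_mul (c := 2) (by norm_num)
    have key := ((hCS.mono (E := 4 * (2 * q)) (by omega)).add
      ((sq dS).mono (by omega))).add (hB.mono (by omega))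
    convert key using 1
    have e : 2 * q - 1 = (q - 1) * 2 + 1 := by omega
    have hy : ∑ i : Fin n, (X (Sum.inl i) : MvPolynomial (Fin n ⊕ Fin n) ℝ) *
        (X (Sum.inr i) ^ q) ^ 2 = ∑ i, X (Sum.inl i) * X (Sum.inr i) ^ (2 * q) :=
      Finset.sum_congr rfl fun i _ => by rw [← pow_mul, mul_comm q 2]
    have hPq : P ^ q = (P ^ m) ^ 2 := by rw [← pow_mul, hm, mul_comm]
    rw [hy, ← hW, ← hA, e, map_ofNat, ← hPq, pow_succ W, pow_mul W, mul_comm 2 q, pow_mul P]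
    ring

theorem complement_weight (m : ℕ) :
    HasBooleanSosCert (8 * (m + 1))
      ((∑ i : Fin n, X (Sum.inl i)) ^ (2 * m + 1) *
        ∑ i : Fin n, (1 - X (Sum.inl i)) * X (Sum.inr i) ^ (2 * (m + 1))) := by
  have h : HasBooleanSosCert (2 * (m * 1) + (2 * ((m + 1) * 1) + 4))
      ((((∑ i : Fin n, X (Sum.inl i)) ^ m) ^ 2) * ∑ i : Fin n, ∑ j : Fin n,
        X (Sum.inl i) * (1 - X (Sum.inl j)) * (X (Sum.inr j) ^ (m + 1)) ^ 2) := by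
    refine (sum _ _ fun i _ => sum _ _ fun j _ => ?_).sq_mul
      (totalDegree_pow_le_mul (totalDegree_sum_X_le _) m)
    exact mul_mul_sq (i := i) (j := j) (totalDegree_X _).le
      (totalDegree_sub_le_of_le (by simp) (totalDegree_X _).le) rfl (by ring)
      (totalDegree_pow_le_mul (totalDegree_X _).le _)
  have e : (∑ i : Fin n, (X (Sum.inl i) : MvPolynomial (Fin n ⊕ Fin n) ℝ)) ^ (2 * m + 1) *
        (∑ i : Fin n, (1 - X (Sum.inl i)) * X (Sum.inr i) ^ (2 * (m + 1))) =
      ((∑ i : Fin n, X (Sum.inl i)) ^ m) ^ 2 * ∑ i : Fin n, ∑ j : Fin n,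
        X (Sum.inl i) * (1 - X (Sum.inl j)) * (X (Sum.inr j) ^ (m + 1)) ^ 2 := by
    rw [pow_succ, mul_assoc, Finset.sum_mul_sum, mul_comm 2 m, pow_mul]
    refine congrArg _ (Finset.sum_congr rfl fun i _ => Finset.sum_congr rfl fun j _ => ?_)
    rw [← pow_mul, mul_comm 2 (m + 1), mul_assoc]
  rw [e]
  exact h.mono (by omega)

end HasBooleanSosCert

/-- **SoS Hölder inequality.** There is a universal constant `C` such that for every `n ≥ 1`
and every power of two `q ≥ 2`, in `ℝ[w₁,…,wₙ,x₁,…,xₙ]` the polynomial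
`(∑ wᵢ)^{q-1}(∑ xᵢ^q) - (∑ wᵢxᵢ)^q` equals a sum-of-squares polynomial `σ` of degree at most
`C·q` plus an element `∑ hᵢ·(wᵢ² - wᵢ)` of the ideal generated by the Booleanness equations,
where each summand `hᵢ·(wᵢ² - wᵢ)` has degree at most `C·q`. -/
theorem stmt_1 : ∃ C : ℕ, ∀ n q : ℕ, 1 ≤ n → 2 ≤ q → (∃ k : ℕ, q = 2 ^ k) →
    ∃ (σ : MvPolynomial (Fin n ⊕ Fin n) ℝ) (h : Fin n → MvPolynomial (Fin n ⊕ Fin n) ℝ),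
      IsSumSq σ ∧ σ.totalDegree ≤ C * q ∧
      (∀ i : Fin n,
        (h i * ((X (Sum.inl i) : MvPolynomial (Fin n ⊕ Fin n) ℝ) ^ 2
          - X (Sum.inl i))).totalDegree ≤ C * q) ∧
      (∑ i : Fin n, (X (Sum.inl i) : MvPolynomial (Fin n ⊕ Fin n) ℝ)) ^ (q - 1) *
          (∑ i : Fin n, X (Sum.inr i) ^ q) -
        (∑ i : Fin n, X (Sum.inl i) * X (Sum.inr i)) ^ q
        = σ + ∑ i : Fin n, h i * (X (Sum.inl i) ^ 2 - X (Sum.inl i)) := by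
  refine ⟨4, fun n q _ hq2 hq => ?_⟩
  obtain ⟨k, rfl⟩ := hq
  obtain _ | k := k
  · norm_num at hq2
  have hpos : 1 ≤ (2 : ℕ) ^ k := Nat.one_le_two_pow
  have hq : (2 : ℕ) ^ (k + 1) = 2 * (2 ^ k - 1 + 1) := by rw [pow_succ]; omega
  have hq' : (2 : ℕ) ^ (k + 1) - 1 = 2 * (2 ^ k - 1) + 1 := by omega
  have h := HasBooleanSosCert.complement_weight (n := n) (2 ^ k - 1)
  rw [← hq, ← hq'] at h
  have key := (HasBooleanSosCert.weighted_holder (n := n) k).add (h.mono (by omega))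
  suffices HasBooleanSosCert (4 * 2 ^ (k + 1)) _ from this
  convert key using 1
  have hsplit : ∑ i : Fin n, (X (Sum.inr i) : MvPolynomial (Fin n ⊕ Fin n) ℝ) ^ 2 ^ (k + 1) =
      (∑ i, X (Sum.inl i) * X (Sum.inr i) ^ 2 ^ (k + 1)) +
        ∑ i, (1 - X (Sum.inl i)) * X (Sum.inr i) ^ 2 ^ (k + 1) := by
    rw [← Finset.sum_add_distrib]
    exact Finset.sum_congr rfl fun i _ => by ring
  rw [hsplit]
  ring
end

section
/- Let P ∈ ℝ[x₁,…,x_n] be a homogeneous polynomial of degree ℓ, write P = ∑_α P̂(α)·x^α in the monomial basis, and suppose ∑_α P̂(α)² ≤ C for some real C ≥ 0. Let a, b ∈ ℕ with a + b = ℓ. Then the polynomial √C·(‖x‖^{2a} + ‖x‖^{2b}) − P(x), where ‖x‖² = ∑_{i=1}^n x_i², is a sum of squares of polynomials each of degree at most max(a,b). -/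
open MvPolynomial

/-- The cone of sums of squares of polynomials of total degree at most `d`. -/
noncomputable def boundedSumSq (σ : Type*) (d : ℕ) : AddSubmonoid (MvPolynomial σ ℝ) :=
  AddSubmonoid.closure {p | ∃ r : MvPolynomial σ ℝ, r.totalDegree ≤ d ∧ p = r ^ 2}

section boundedSumSq

variable {σ : Type*} {d : ℕ} {p : MvPolynomial σ ℝ}

theorem sq_mem_boundedSumSq (hp : p.totalDegree ≤ d) : p ^ 2 ∈ boundedSumSq σ d :=
  AddSubmonoid.subset_closure ⟨p, hp, rfl⟩

theorem smul_mem_boundedSumSq {c : ℝ} (hc : 0 ≤ c) (hp : p ∈ boundedSumSq σ d) :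
    c • p ∈ boundedSumSq σ d := by
  induction hp using AddSubmonoid.closure_induction with
  | mem x hx =>
    obtain ⟨r, hr, rfl⟩ := hx
    have h : c • r ^ 2 = (√c • r) ^ 2 := by rw [smul_pow, Real.sq_sqrt hc]
    rw [h]
    exact sq_mem_boundedSumSq ((totalDegree_smul_le _ _).trans hr)
  | zero => simp
  | add x y _ _ hx hy => rw [smul_add]; exact add_mem hx hy

theorem exists_fin_of_mem_boundedSumSq (hp : p ∈ boundedSumSq σ d) :
    ∃ (N : ℕ) (r : Fin N → MvPolynomial σ ℝ),
      (∀ j, (r j).totalDegree ≤ d) ∧ p = ∑ j, r j ^ 2 := by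
  induction hp using AddSubmonoid.closure_induction with
  | mem x hx =>
    obtain ⟨r, hr, rfl⟩ := hx
    exact ⟨1, fun _ => r, fun _ => hr, by simp⟩
  | zero => exact ⟨0, Fin.elim0, fun j => j.elim0, by simp⟩
  | add x y _ _ hx hy =>
    obtain ⟨N, r, hr, rfl⟩ := hx
    obtain ⟨M, s, hs, rfl⟩ := hy
    refine ⟨N + M, Fin.append r s, fun j => ?_, by simp [Fin.sum_univ_add]⟩
    induction j using Fin.addCases <;> simp [hr, hs]

theorem totalDegree_sum_smul_le {κ : Type*} [Fintype κ] (m : κ → ℝ)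
    {v : κ → MvPolynomial σ ℝ} (hv : ∀ g, (v g).totalDegree ≤ d) :
    (∑ g, m g • v g).totalDegree ≤ d :=
  totalDegree_finsetSum_le fun g _ => (totalDegree_smul_le _ _).trans (hv g)

/-- The Cauchy–Schwarz inequality, certified by Lagrange's identity. -/
theorem cauchySchwarz_mem_boundedSumSq {κ : Type*} [Fintype κ] (m : κ → ℝ)
    {v : κ → MvPolynomial σ ℝ} (hv : ∀ g, (v g).totalDegree ≤ d) :
    (∑ g, m g ^ 2) • ∑ g, v g ^ 2 - (∑ g, m g • v g) ^ 2 ∈ boundedSumSq σ d := by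
  have lagrange : (∑ g, m g ^ 2) • ∑ g, v g ^ 2 - (∑ g, m g • v g) ^ 2
      = (1 / 2 : ℝ) • ∑ g, ∑ h, (m g • v h - m h • v g) ^ 2 := by
    have expand : ∀ g h, (m g • v h - m h • v g) ^ 2
        = m g ^ 2 • v h ^ 2 + m h ^ 2 • v g ^ 2 - (2 : ℝ) • ((m g • v g) * (m h • v h)) := by
      intro g h
      simp only [smul_eq_C_mul, map_pow, map_ofNat]
      ring
    simp only [expand, Finset.sum_add_distrib, Finset.sum_sub_distrib, ← Finset.smul_sum,
      ← Finset.sum_mul_sum, ← Finset.sum_smul, ← sq]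
    module
  rw [lagrange]
  refine smul_mem_boundedSumSq (by norm_num) (sum_mem fun g _ => sum_mem fun h _ => ?_)
  exact sq_mem_boundedSumSq ((totalDegree_sub _ _).trans
    (max_le ((totalDegree_smul_le _ _).trans (hv h)) ((totalDegree_smul_le _ _).trans (hv g))))

/-- A bilinear form whose matrix has Frobenius norm at most `s` is bounded by `s` times the sum
of the squared norms of its arguments, certifiably. -/
theorem bilinear_mem_boundedSumSq {ι κ : Type*} [Fintype ι] [Fintype κ] {s : ℝ} (hs : 0 < s)
    (m : ι → κ → ℝ) (hm : ∑ f, ∑ g, m f g ^ 2 ≤ s ^ 2)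
    {u : ι → MvPolynomial σ ℝ} {v : κ → MvPolynomial σ ℝ}
    (hu : ∀ f, (u f).totalDegree ≤ d) (hv : ∀ g, (v g).totalDegree ≤ d) :
    s • (∑ f, u f ^ 2 + ∑ g, v g ^ 2) - ∑ f, ∑ g, m f g • (u f * v g) ∈ boundedSumSq σ d := by
  set q : ι → MvPolynomial σ ℝ := fun f => ∑ g, m f g • v g with hq
  have hform : ∑ f, ∑ g, m f g • (u f * v g) = ∑ f, u f * q f := by
    simp [hq, Finset.mul_sum]
  have complete_square : ∀ f, s • (u f - (1 / (2 * s)) • q f) ^ 2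
      = s • u f ^ 2 - u f * q f + (1 / (4 * s)) • q f ^ 2 := by
    intro f
    have h₁ : (C s * C (1 / (2 * s)) : MvPolynomial σ ℝ) = C (1 / 2) := by
      rw [← C_mul]; congr 1; field_simp
    have h₂ : (C (1 / (4 * s)) : MvPolynomial σ ℝ) = C (1 / 2) * C (1 / (2 * s)) := by
      rw [← C_mul]; congr 1; field_simp; norm_num
    have h₃ : (2 * C (1 / 2) : MvPolynomial σ ℝ) = 1 := by
      rw [← map_ofNat (C : ℝ →+* MvPolynomial σ ℝ) 2, ← C_mul]; norm_num
    simp only [smul_eq_C_mul, h₂]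
    linear_combination (-2 * u f * q f + C (1 / (2 * s)) * q f ^ 2) * h₁ - u f * q f * h₃
  have key : s • (∑ f, u f ^ 2 + ∑ g, v g ^ 2) - ∑ f, ∑ g, m f g • (u f * v g)
      = ∑ f, s • (u f - (1 / (2 * s)) • q f) ^ 2
        + (1 / (4 * s)) • (∑ f, ((∑ g, m f g ^ 2) • ∑ g, v g ^ 2 - q f ^ 2)
          + (4 * s ^ 2 - ∑ f, ∑ g, m f g ^ 2) • ∑ g, v g ^ 2) := by
    simp only [hform, complete_square, Finset.sum_add_distrib, Finset.sum_sub_distrib,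
      ← Finset.smul_sum, ← Finset.sum_smul]
    match_scalars <;> field_simp <;> ring
  rw [key]
  refine add_mem (sum_mem fun f _ => smul_mem_boundedSumSq hs.le (sq_mem_boundedSumSq ?_))
    (smul_mem_boundedSumSq (by positivity) (add_mem
      (sum_mem fun f _ => cauchySchwarz_mem_boundedSumSq _ hv)
      (smul_mem_boundedSumSq (by nlinarith) (sum_mem fun g _ => sq_mem_boundedSumSq (hv g)))))
  exact (totalDegree_sub _ _).trans
    (max_le (hu f) ((totalDegree_smul_le _ _).trans (totalDegree_sum_smul_le _ hv)))

end boundedSumSq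

/-- The exponent of the monomial `∏ j, X (f j)`. -/
noncomputable def tupleExponent {σ : Type*} {k : ℕ} (f : Fin k → σ) : σ →₀ ℕ :=
  ∑ j, Finsupp.single (f j) 1

theorem monomial_tupleExponent {σ : Type*} {k : ℕ} (f : Fin k → σ) :
    monomial (tupleExponent f) (1 : ℝ) = ∏ j, X (f j) :=
  monomial_sum_one _ _

theorem totalDegree_monomial_tupleExponent_le {σ : Type*} {k : ℕ} (f : Fin k → σ) :
    (monomial (tupleExponent f) (1 : ℝ)).totalDegree ≤ k := by
  rw [monomial_tupleExponent]
  refine (totalDegree_finsetProd _ _).trans ?_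
  simp

theorem sum_monomial_tupleExponent_sq {σ : Type*} [Fintype σ] (k : ℕ) :
    ∑ f : Fin k → σ, monomial (tupleExponent f) (1 : ℝ) ^ 2 = (∑ i, X i ^ 2) ^ k := by
  simp only [monomial_tupleExponent, Fintype.sum_pow, Finset.prod_pow]

theorem exists_tupleExponent_eq {σ : Type*} (α : σ →₀ ℕ) :
    ∃ f : Fin α.degree → σ, tupleExponent f = α := by
  generalize hk : α.degree = k
  induction k generalizing α with
  | zero => exact ⟨Fin.elim0, by simp [tupleExponent, (Finsupp.degree_eq_zero_iff α).1 hk]⟩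
  | succ k ih =>
    have hα : α ≠ 0 := by rintro rfl; simp at hk
    obtain ⟨i, hi⟩ := Finsupp.ne_iff.1 hα
    have hle : Finsupp.single i 1 ≤ α := by
      rw [Finsupp.single_le_iff]; exact Nat.one_le_iff_ne_zero.2 hi
    obtain ⟨β, rfl⟩ := exists_add_of_le hle
    obtain ⟨f, hf⟩ := ih β (by simp at hk; omega)
    exact ⟨Fin.cons i f, by simp [tupleExponent, Fin.sum_univ_succ, ← hf]⟩

theorem exists_tupleExponent_add_eq {σ : Type*} {a b : ℕ} {α : σ →₀ ℕ} (hα : α.degree = a + b) :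
    ∃ p : (Fin a → σ) × (Fin b → σ), tupleExponent p.1 + tupleExponent p.2 = α := by
  obtain ⟨f, hf⟩ := exists_tupleExponent_eq α
  rw [← hf]
  clear hf
  revert f
  rw [hα]
  intro f
  exact ⟨(fun j => f (Fin.castAdd b j), fun j => f (Fin.natAdd a j)),
    by simp [tupleExponent, Fin.sum_univ_add]⟩

theorem Set.BijOn.sum_ite_mem {ι κ M : Type*} [Fintype ι] [AddCommMonoid M] {e : ι → κ}
    {T : Set ι} [DecidablePred (· ∈ T)] {s : Finset κ} (h : Set.BijOn e T s) (F : κ → M) :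
    ∑ p, (if p ∈ T then F (e p) else 0) = ∑ k ∈ s, F k := by
  rw [← Finset.sum_filter]
  refine Finset.sum_nbij e (fun p hp => h.mapsTo (Finset.mem_filter.1 hp).2) ?_ ?_ fun _ _ => rfl
  · simpa using h.injOn
  · simpa using h.surjOn

/-- A form of degree `a + b` is a bilinear form in the monomials of degrees `a` and `b`, with a
matrix whose Frobenius norm is the `ℓ₂` norm of the coefficients. -/
theorem MvPolynomial.IsHomogeneous.exists_bilinear {σ : Type*} [Fintype σ] {a b : ℕ}
    {P : MvPolynomial σ ℝ} (hP : P.IsHomogeneous (a + b)) :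
    ∃ m : (Fin a → σ) → (Fin b → σ) → ℝ,
      ∑ f, ∑ g, m f g ^ 2 = ∑ α ∈ P.support, P.coeff α ^ 2 ∧
      ∑ f, ∑ g, m f g • (monomial (tupleExponent f) (1 : ℝ) * monomial (tupleExponent g) (1 : ℝ))
        = P := by
  classical
  let e : (Fin a → σ) × (Fin b → σ) → σ →₀ ℕ := fun p => tupleExponent p.1 + tupleExponent p.2
  have hsurj : Set.SurjOn e Set.univ P.support := fun α hα => by
    have hdeg : α.degree = a + b := by
      rw [Finsupp.degree_eq_weight_one]
      exact hP (mem_support_iff.1 hα)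
    obtain ⟨p, hp⟩ := exists_tupleExponent_add_eq hdeg
    exact ⟨p, Set.mem_univ p, hp⟩
  obtain ⟨T, -, hT⟩ := hsurj.exists_bijOn_subset
  let m : (Fin a → σ) × (Fin b → σ) → ℝ := fun p => if p ∈ T then P.coeff (e p) else 0
  refine ⟨fun f g => m (f, g), ?_, ?_⟩
  · rw [← Fintype.sum_prod_type' fun f g => m (f, g) ^ 2, ← hT.sum_ite_mem]
    simp [m, ite_pow]
  · rw [← Fintype.sum_prod_type' fun f g => m (f, g) •
      (monomial (tupleExponent f) (1 : ℝ) * monomial (tupleExponent g) (1 : ℝ))]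
    conv_rhs => rw [P.as_sum, ← hT.sum_ite_mem fun α => monomial α (P.coeff α)]
    simp [m, e, ite_smul, monomial_mul, smul_monomial]

/-- A homogeneous degree-`ℓ` polynomial `P` whose coefficient vector has squared `ℓ₂`-norm
at most `C` satisfies `P(x) ≤ √C(‖x‖^{2a} + ‖x‖^{2b})` for any `a + b = ℓ`, certifiably:
the difference is a sum of squares of polynomials each of degree at most `max a b`. -/
theorem stmt_2 {n : ℕ} (P : MvPolynomial (Fin n) ℝ) (ℓ : ℕ)
    (hhom : P.IsHomogeneous ℓ) (C : ℝ) (hC : 0 ≤ C)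
    (hcoeff : ∑ α ∈ P.support, (P.coeff α) ^ 2 ≤ C)
    (a b : ℕ) (hab : a + b = ℓ) :
    ∃ (N : ℕ) (r : Fin N → MvPolynomial (Fin n) ℝ),
      (∀ j, (r j).totalDegree ≤ max a b) ∧
      MvPolynomial.C (Real.sqrt C) *
          ((∑ i : Fin n, X i ^ 2) ^ a + (∑ i : Fin n, X i ^ 2) ^ b) - P
        = ∑ j, (r j) ^ 2 := by
  subst hab
  apply exists_fin_of_mem_boundedSumSq
  rw [← smul_eq_C_mul]
  obtain rfl | hpos := hC.eq_or_lt
  · have hP : P = 0 := by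
      ext α
      by_contra hα
      have hle := Finset.single_le_sum (f := fun β => P.coeff β ^ 2) (fun β _ => sq_nonneg _)
        (mem_support_iff.2 hα)
      exact hα (pow_eq_zero_iff two_ne_zero |>.1
        (le_antisymm (hle.trans hcoeff) (sq_nonneg _)))
    simp [hP]
  · obtain ⟨m, hm, hbil⟩ := hhom.exists_bilinear
    have h := bilinear_mem_boundedSumSq (d := max a b) (Real.sqrt_pos.2 hpos) m
      (by rwa [hm, Real.sq_sqrt hC])
      (fun f => (totalDegree_monomial_tupleExponent_le f).trans (le_max_left a b))
      (fun g => (totalDegree_monomial_tupleExponent_le g).trans (le_max_right a b))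
    rwa [hbil, sum_monomial_tupleExponent_sq, sum_monomial_tupleExponent_sq] at h
end

section
/- Let a, b ∈ ℝ^k and let t be a power of two. Then the polynomial ‖a − u‖^t + ‖b − u‖^t − 2^{−t}·‖a − b‖^t in the variables u = (u₁,…,u_k) is a sum of squares, where ‖z‖^t denotes (∑_{i=1}^k z_i²)^{t/2}. -/
open MvPolynomial

theorem IsSumSq.sq_add_sq_sub_two_mul_sq {R : Type*} [CommRing R] [Invertible (2 : R)] {x y e : R}
    (hx : IsSumSq x) (hy : IsSumSq y) (he : IsSumSq e) (h : IsSumSq (x + y - 2 * e)) :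
    IsSumSq (x ^ 2 + y ^ 2 - 2 * e ^ 2) := by
  have half : (2 : R) * ⅟2 = 1 := mul_invOf_self 2
  have half_sumSq : IsSumSq (⅟2 : R) := by
    have : (⅟2 : R) = ⅟2 * ⅟2 + ⅟2 * ⅟2 := by linear_combination -⅟2 * half
    rw [this]
    exact (IsSumSq.mul_self _).add (IsSumSq.mul_self _)
  have key : x ^ 2 + y ^ 2 - 2 * e ^ 2 =
      ⅟2 * ((x - y) * (x - y) + (x + y - 2 * e) * (x + y + (e + e))) := by
    linear_combination (-(x ^ 2 + y ^ 2 - 2 * e ^ 2)) * half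
  rw [key]
  exact half_sumSq.mul ((IsSumSq.mul_self _).add (h.mul ((hx.add hy).add (he.add he))))

theorem IsSumSq.pow_two_pow_add_sub_two_mul {R : Type*} [CommRing R] [Invertible (2 : R)]
    {x y e : R} (hx : IsSumSq x) (hy : IsSumSq y) (he : IsSumSq e)
    (h : IsSumSq (x + y - 2 * e)) (j : ℕ) :
    IsSumSq (x ^ 2 ^ j + y ^ 2 ^ j - 2 * e ^ 2 ^ j) := by
  induction j generalizing x y e with
  | zero => simpa using h
  | succ j ih =>
    have sq {z : R} : IsSumSq (z ^ 2) := (IsSquare.sq z).isSumSq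
    simpa only [pow_succ' 2 j, pow_mul] using
      ih sq sq sq (hx.sq_add_sq_sub_two_mul_sq hy he h)

/-- **SoS triangle inequality.** For `a, b ∈ ℝ^k` and `t` a power of two, the polynomial
`‖a - u‖^t + ‖b - u‖^t - 2^{-t}‖a - b‖^t` in the variables `u = (u₁,…,u_k)` is a sum of
squares, where `‖z‖^t` denotes `(∑ zᵢ²)^{t/2}`. -/
theorem stmt_3 {k : ℕ} (a b : Fin k → ℝ) (t m : ℕ) (hm : 1 ≤ m) (ht : t = 2 ^ m) :
    IsSumSq ((∑ i : Fin k, (C (a i) - X i) ^ 2) ^ (t / 2)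
      + (∑ i : Fin k, (C (b i) - X i) ^ 2) ^ (t / 2)
      - C (((2 : ℝ)⁻¹) ^ t * (∑ i : Fin k, (a i - b i) ^ 2) ^ (t / 2))) := by
  obtain ⟨j, rfl⟩ := Nat.exists_eq_add_of_le' hm
  have ht2 : t = 2 * 2 ^ j := by rw [ht, pow_succ']
  have htd : t / 2 = 2 ^ j := by omega
  have half : (2 : MvPolynomial (Fin k) ℝ) * C 2⁻¹ = 1 := by
    rw [← map_ofNat C 2, ← C_mul]
    norm_num
  let : Invertible (2 : MvPolynomial (Fin k) ℝ) := ⟨C 2⁻¹, by rw [mul_comm, half], half⟩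
  set e : MvPolynomial (Fin k) ℝ := ∑ i : Fin k, (C 2⁻¹ * (C (a i) - C (b i))) ^ 2 with he_def
  have he : IsSumSq e := IsSumSq.sum_sq _ _
  have base : IsSumSq ((∑ i : Fin k, (C (a i) - X i) ^ 2) + (∑ i : Fin k, (C (b i) - X i) ^ 2)
      - 2 * e) := by
    have : (∑ i : Fin k, (C (a i) - X i) ^ 2) + (∑ i : Fin k, (C (b i) - X i) ^ 2) - 2 * e =
        ∑ i : Fin k, ((C 2⁻¹ * (C (a i) + C (b i)) - X i) ^ 2 +
          (C 2⁻¹ * (C (a i) + C (b i)) - X i) ^ 2) := by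
      rw [he_def, Finset.mul_sum, ← Finset.sum_add_distrib, ← Finset.sum_sub_distrib]
      refine Finset.sum_congr rfl fun i _ => ?_
      linear_combination (2 * X i * (C (a i) + C (b i)) -
        (C (a i) ^ 2 + C (b i) ^ 2) * (1 + 2 * C 2⁻¹)) * half
    rw [this, Finset.sum_add_distrib]
    exact (IsSumSq.sum_sq _ _).add (IsSumSq.sum_sq _ _)
  have hconst : C (((2 : ℝ)⁻¹) ^ t * (∑ i : Fin k, (a i - b i) ^ 2) ^ (t / 2)) = e ^ 2 ^ j := by
    rw [htd, ht2, pow_mul, ← mul_pow, C_pow, he_def, Finset.mul_sum, map_sum]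
    simp only [mul_pow, C_mul, C_pow, C_sub]
  rw [hconst, htd]
  have hpow : IsSumSq (e ^ 2 ^ j) :=
    Subsemiring.mem_sumSq.1 (pow_mem (Subsemiring.mem_sumSq.2 he) _)
  have main := (IsSumSq.pow_two_pow_add_sub_two_mul (IsSumSq.sum_sq _ _) (IsSumSq.sum_sq _ _) he
    base j).add hpow
  rwa [two_mul, sub_add, add_sub_cancel_right] at main
end

section
/- Let t ≥ 2 be even, let X₁,…,X_m ∈ ℝ^d, let v ∈ ℝ^d with ‖v‖ ≤ 1, set Y_i = X_i + v for each i, and let C ≥ 1 be such that (1/m)·∑_{i=1}^m ‖X_i‖^s ≤ C^s for every integer 1 ≤ s ≤ t. Then the polynomial 2^t·C^{t−1}·‖v‖·‖u‖^t − (1/m)·∑_{i=1}^m (⟨X_i,u⟩^t − ⟨Y_i,u⟩^t) in the variables u = (u₁,…,u_d) is a sum of squares, and the same is true with the roles of the X_i and Y_i exchanged. -/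
open MvPolynomial

/-- `p` is bounded by `q` in absolute value, with sum-of-squares certificates. -/
def SumSqBound {R : Type*} [CommRing R] (q p : R) : Prop :=
  IsSumSq (q - p) ∧ IsSumSq (q + p)

theorem IsSumSq.congr {R : Type*} [CommRing R] {a b : R} (ha : IsSumSq a) (h : b = a) :
    IsSumSq b :=
  h ▸ ha

namespace SumSqBound

section Ring

variable {R : Type*} [CommRing R] {q p q₁ p₁ q₂ p₂ s : R}

theorem zero : SumSqBound (0 : R) 0 := by
  simp [SumSqBound]

theorem one : SumSqBound (1 : R) 1 := by
  exact ⟨by simp, IsSumSq.add (by simp) (by simp)⟩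

theorem add (h₁ : SumSqBound q₁ p₁) (h₂ : SumSqBound q₂ p₂) :
    SumSqBound (q₁ + q₂) (p₁ + p₂) := by
  constructor
  · exact IsSumSq.congr (h₁.1.add h₂.1) (by ring)
  · exact IsSumSq.congr (h₁.2.add h₂.2) (by ring)

theorem sum {ι : Type*} (A : Finset ι) {f g : ι → R} (h : ∀ i ∈ A, SumSqBound (f i) (g i)) :
    SumSqBound (∑ i ∈ A, f i) (∑ i ∈ A, g i) := by
  classical
  induction A using Finset.induction_on with
  | empty => simpa using zero
  | insert a A ha ih =>
    rw [Finset.sum_insert ha, Finset.sum_insert ha]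
    exact (h a (by simp)).add (ih fun i hi => h i (by simp [hi]))

theorem sumSq_mul (hs : IsSumSq s) (h : SumSqBound q p) : SumSqBound (s * q) (s * p) := by
  constructor
  · exact IsSumSq.congr (hs.mul h.1) (by ring)
  · exact IsSumSq.congr (hs.mul h.2) (by ring)

theorem mono_left (h : SumSqBound q₁ p) (hq : IsSumSq (q₂ - q₁)) : SumSqBound q₂ p := by
  constructor
  · exact IsSumSq.congr (hq.add h.1) (by ring)
  · exact IsSumSq.congr (hq.add h.2) (by ring)

end Ring

variable {σ : Type*}

theorem _root_.MvPolynomial.isSumSq_C {c : ℝ} (hc : 0 ≤ c) :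
    IsSumSq (C c : MvPolynomial σ ℝ) := by
  rw [← Real.mul_self_sqrt hc, C_mul]
  exact IsSumSq.mul_self _

theorem of_C_mul {c : ℝ} (hc : 0 < c) {q p : MvPolynomial σ ℝ}
    (h : SumSqBound (C c * q) (C c * p)) : SumSqBound q p := by
  have := h.sumSq_mul (isSumSq_C (inv_nonneg.2 hc.le))
  simpa only [← mul_assoc, ← C_mul, inv_mul_cancel₀ hc.ne', C_1, one_mul] using this

theorem mul {q₁ p₁ q₂ p₂ : MvPolynomial σ ℝ} (h₁ : SumSqBound q₁ p₁) (h₂ : SumSqBound q₂ p₂) :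
    SumSqBound (q₁ * q₂) (p₁ * p₂) := by
  refine of_C_mul two_pos ?_
  rw [show (C (2 : ℝ) : MvPolynomial σ ℝ) = 2 from map_ofNat C 2]
  constructor
  · exact IsSumSq.congr ((h₁.1.mul h₂.2).add (h₁.2.mul h₂.1)) (by ring)
  · exact IsSumSq.congr ((h₁.1.mul h₂.1).add (h₁.2.mul h₂.2)) (by ring)

theorem pow {q p : MvPolynomial σ ℝ} (h : SumSqBound q p) (n : ℕ) :
    SumSqBound (q ^ n) (p ^ n) := by
  induction n with
  | zero => simpa using one
  | succ n ih => simpa only [pow_succ] using ih.mul h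

end SumSqBound

section LinearForm

variable {d : ℕ}

/-- The polynomial `⟨x, u⟩` in the variables `u`. -/
noncomputable def linearForm (x : EuclideanSpace ℝ (Fin d)) : MvPolynomial (Fin d) ℝ :=
  ∑ j, C (x j) * X j

/-- The polynomial `‖u‖ ^ 2` in the variables `u`. -/
noncomputable def normSqForm (d : ℕ) : MvPolynomial (Fin d) ℝ := ∑ j, X j ^ 2

theorem linearForm_add (x y : EuclideanSpace ℝ (Fin d)) :
    linearForm (x + y) = linearForm x + linearForm y := by
  simp [linearForm, add_mul, Finset.sum_add_distrib]

theorem isSumSq_normSqForm : IsSumSq (normSqForm d) :=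
  IsSumSq.sum fun j _ => by rw [pow_two]; exact IsSumSq.mul_self _

theorem isSumSq_normSqForm_pow (n : ℕ) : IsSumSq (normSqForm d ^ n) := by
  induction n with
  | zero => simp
  | succ n ih => rw [pow_succ]; exact ih.mul isSumSq_normSqForm

/-- The Cauchy-Schwarz inequality with the sum-of-squares certificate of Lagrange's identity. -/
theorem isSumSq_cauchySchwarz (x : EuclideanSpace ℝ (Fin d)) :
    IsSumSq (C (‖x‖ ^ 2) * normSqForm d - linearForm x ^ 2) := by
  have key : C (‖x‖ ^ 2) * normSqForm d - linearForm x ^ 2 = C (2⁻¹ : ℝ) *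
      ∑ i, ∑ j, (C (x i) * X j - C (x j) * X i) * (C (x i) * X j - C (x j) * X i) := by
    have h : ∑ i, ∑ j, (C (x i) * X j - C (x j) * X i) * (C (x i) * X j - C (x j) * X i)
        = C (2 : ℝ) * (C (‖x‖ ^ 2) * normSqForm d - linearForm x ^ 2) := by
      have e : ∀ i j : Fin d,
          (C (x i) * X j - C (x j) * X i) * (C (x i) * X j - C (x j) * X i)
          = C (x i) ^ 2 * X j ^ 2 + X i ^ 2 * C (x j) ^ 2
            - 2 * ((C (x i) * X i) * (C (x j) * X j) : MvPolynomial (Fin d) ℝ) := by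
        intro i j; ring
      have hn : (C (‖x‖ ^ 2) : MvPolynomial (Fin d) ℝ) = ∑ i, C (x i) ^ 2 := by
        simp [EuclideanSpace.real_norm_sq_eq]
      simp only [e, Finset.sum_add_distrib, Finset.sum_sub_distrib, ← Finset.mul_sum,
        ← Finset.sum_mul]
      rw [hn, show (C (2 : ℝ) : MvPolynomial (Fin d) ℝ) = 2 from map_ofNat C 2, linearForm,
        normSqForm]
      ring
    rw [h, ← mul_assoc, ← C_mul]
    norm_num
  rw [key]
  exact (isSumSq_C (by norm_num)).mul
    (IsSumSq.sum fun i _ => IsSumSq.sum fun j _ => IsSumSq.mul_self _)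

theorem sumSqBound_linearForm_mul (x w : EuclideanSpace ℝ (Fin d)) :
    SumSqBound (C (‖x‖ * ‖w‖) * normSqForm d) (linearForm x * linearForm w) := by
  rcases eq_or_ne x 0 with rfl | hx
  · simpa [linearForm] using SumSqBound.zero
  rcases eq_or_ne w 0 with rfl | hw
  · simpa [linearForm] using SumSqBound.zero
  have hx' := norm_pos_iff.2 hx
  have hw' := norm_pos_iff.2 hw
  refine SumSqBound.of_C_mul (c := 2 * (‖x‖ * ‖w‖)) (by positivity) ?_
  have h2 : (C (2 : ℝ) : MvPolynomial (Fin d) ℝ) = 2 := map_ofNat C 2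
  have hS := ((isSumSq_C (sq_nonneg ‖w‖)).mul (isSumSq_cauchySchwarz x)).add
    ((isSumSq_C (sq_nonneg ‖x‖)).mul (isSumSq_cauchySchwarz w))
  constructor
  · refine IsSumSq.congr (hS.add (IsSumSq.mul_self (C ‖w‖ * linearForm x - C ‖x‖ * linearForm w))) ?_
    simp only [C_mul, C_pow, h2]
    ring
  · refine IsSumSq.congr (hS.add (IsSumSq.mul_self (C ‖w‖ * linearForm x + C ‖x‖ * linearForm w))) ?_
    simp only [C_mul, C_pow, h2]
    ring

theorem sumSqBound_linearForm_pow_mul_pow (x w : EuclideanSpace ℝ (Fin d)) {a b n : ℕ}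
    (h : a + b = 2 * n) :
    SumSqBound (C (‖x‖ ^ a * ‖w‖ ^ b) * normSqForm d ^ n)
      (linearForm x ^ a * linearForm w ^ b) := by
  have hxx := sumSqBound_linearForm_mul x x
  have hww := sumSqBound_linearForm_mul w w
  rcases Nat.even_or_odd' a with ⟨k, rfl | rfl⟩
  · obtain ⟨l, rfl⟩ : ∃ l, b = 2 * l := ⟨n - k, by omega⟩
    obtain rfl : n = k + l := by omega
    convert (hxx.pow k).mul (hww.pow l) using 1
    · simp only [C_mul, C_pow]; ring
    · ring
  · obtain ⟨l, rfl⟩ : ∃ l, b = 2 * l + 1 := ⟨n - k - 1, by omega⟩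
    obtain rfl : n = k + l + 1 := by omega
    convert ((hxx.pow k).mul (hww.pow l)).mul (sumSqBound_linearForm_mul x w) using 1
    · simp only [C_mul, C_pow]; ring
    · ring

theorem sumSqBound_linearForm_add_pow_sub (x w : EuclideanSpace ℝ (Fin d)) (n : ℕ) :
    SumSqBound
      (C (∑ k ∈ Finset.range (2 * n), ‖x‖ ^ k * ‖w‖ ^ (2 * n - k) * ((2 * n).choose k : ℝ)) *
        normSqForm d ^ n)
      (linearForm (x + w) ^ (2 * n) - linearForm x ^ (2 * n)) := by
  rw [linearForm_add, add_pow, Finset.sum_range_succ, map_sum, Finset.sum_mul]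
  simp only [Nat.sub_self, pow_zero, mul_one, Nat.choose_self, Nat.cast_one, add_sub_cancel_right]
  refine SumSqBound.sum _ fun k hk => ?_
  have hk' := Finset.mem_range.1 hk
  convert (sumSqBound_linearForm_pow_mul_pow x w (a := k) (b := 2 * n - k) (n := n)
    (by omega)).sumSq_mul (isSumSq_C (Nat.cast_nonneg ((2 * n).choose k))) using 1
  · simp only [C_mul]; ring
  · simp only [map_natCast]; ring

end LinearForm

theorem mean_sum_binomial_le {ι : Type*} [Fintype ι] [Nonempty ι] (a : ι → ℝ) {t : ℕ} {r c : ℝ}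
    (hr0 : 0 ≤ r) (hr1 : r ≤ 1) (hc : 1 ≤ c)
    (hmom : ∀ s : ℕ, 1 ≤ s → s ≤ t → (Fintype.card ι : ℝ)⁻¹ * ∑ i, a i ^ s ≤ c ^ s) :
    (Fintype.card ι : ℝ)⁻¹ * ∑ i, ∑ k ∈ Finset.range t, a i ^ k * r ^ (t - k) * (t.choose k : ℝ)
      ≤ 2 ^ t * c ^ (t - 1) * r := by
  have hmom' : ∀ s < t, (Fintype.card ι : ℝ)⁻¹ * ∑ i, a i ^ s ≤ c ^ s := by
    intro s hs
    rcases Nat.eq_zero_or_pos s with rfl | h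
    · simp
    · exact hmom s h hs.le
  calc
    _ = ∑ k ∈ Finset.range t,
        ((Fintype.card ι : ℝ)⁻¹ * ∑ i, a i ^ k) * r ^ (t - k) * (t.choose k : ℝ) := by
      rw [Finset.sum_comm, Finset.mul_sum]
      refine Finset.sum_congr rfl fun k _ => ?_
      rw [← Finset.sum_mul, ← Finset.sum_mul]
      ring
    _ ≤ ∑ k ∈ Finset.range t, c ^ (t - 1) * r * (t.choose k : ℝ) := by
      refine Finset.sum_le_sum fun k hk => ?_
      have hk' := Finset.mem_range.1 hk
      have h1 : (Fintype.card ι : ℝ)⁻¹ * ∑ i, a i ^ k ≤ c ^ (t - 1) :=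
        (hmom' k hk').trans (pow_le_pow_right₀ hc (by omega))
      have h2 : r ^ (t - k) ≤ r := pow_le_of_le_one hr0 hr1 (by omega)
      gcongr
    _ ≤ ∑ k ∈ Finset.range (t + 1), c ^ (t - 1) * r * (t.choose k : ℝ) := by
      rw [Finset.sum_range_succ]
      have : 0 ≤ c ^ (t - 1) * r * (t.choose t : ℝ) := by positivity
      linarith
    _ = 2 ^ t * c ^ (t - 1) * r := by
      rw [← Finset.mul_sum, ← Nat.cast_sum, Nat.sum_range_choose]
      push_cast
      ring

/-- Shifting all samples by a vector `v` of norm at most `1` changes the empirical `t`-th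
moment polynomial by at most `2^t C^{t-1}‖v‖·‖u‖^t`, with a sum-of-squares certificate:
if `Yᵢ = Xᵢ + v` and `(1/m)∑‖Xᵢ‖^s ≤ C^s` for all `1 ≤ s ≤ t`, then both
`2^t C^{t-1}‖v‖·‖u‖^t - (1/m)∑(⟨Xᵢ,u⟩^t - ⟨Yᵢ,u⟩^t)` and the version with `X` and `Y`
exchanged are sums of squares. -/
theorem stmt_4 {d m : ℕ} (hm : 1 ≤ m) (t : ℕ) (ht2 : 2 ≤ t) (hte : Even t)
    (Xv : Fin m → EuclideanSpace ℝ (Fin d))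
    (v : EuclideanSpace ℝ (Fin d)) (hv : ‖v‖ ≤ 1)
    (Yv : Fin m → EuclideanSpace ℝ (Fin d)) (hY : ∀ i, Yv i = Xv i + v)
    (Cc : ℝ) (hCc : 1 ≤ Cc)
    (hmom : ∀ s : ℕ, 1 ≤ s → s ≤ t → (m : ℝ)⁻¹ * ∑ i : Fin m, ‖Xv i‖ ^ s ≤ Cc ^ s) :
    IsSumSq (C ((2 : ℝ) ^ t * Cc ^ (t - 1) * ‖v‖) * (∑ j : Fin d, X j ^ 2) ^ (t / 2)
        - C ((m : ℝ)⁻¹) * ∑ i : Fin m,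
            ((∑ j : Fin d, C (Xv i j) * X j) ^ t - (∑ j : Fin d, C (Yv i j) * X j) ^ t))
    ∧ IsSumSq (C ((2 : ℝ) ^ t * Cc ^ (t - 1) * ‖v‖) * (∑ j : Fin d, X j ^ 2) ^ (t / 2)
        - C ((m : ℝ)⁻¹) * ∑ i : Fin m,
            ((∑ j : Fin d, C (Yv i j) * X j) ^ t - (∑ j : Fin d, C (Xv i j) * X j) ^ t)) := by
  obtain ⟨n, rfl⟩ := hte.two_dvd
  have : NeZero m := ⟨by omega⟩
  have hcoef := mean_sum_binomial_le (fun i => ‖Xv i‖) (norm_nonneg v) hv hCc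
    (by simpa using hmom)
  rw [Fintype.card_fin] at hcoef
  have hsum := (SumSqBound.sum Finset.univ fun i _ =>
    sumSqBound_linearForm_add_pow_sub (Xv i) v n).sumSq_mul
      (isSumSq_C (inv_nonneg.2 (Nat.cast_nonneg m)))
  rw [← Finset.sum_mul, ← map_sum, ← mul_assoc, ← C_mul] at hsum
  have hbound := hsum.mono_left
    (q₂ := C ((2 : ℝ) ^ (2 * n) * Cc ^ (2 * n - 1) * ‖v‖) * normSqForm d ^ n) (by
      rw [← sub_mul, ← C_sub]
      exact (isSumSq_C (sub_nonneg.2 hcoef)).mul (isSumSq_normSqForm_pow n))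
  simp only [← hY, linearForm, normSqForm] at hbound
  rw [Nat.mul_div_cancel_left n two_pos]
  refine ⟨?_, hbound.1⟩
  refine hbound.2.congr ?_
  simp only [Finset.sum_sub_distrib]
  ring
end

section
/- Let t ≥ 4, d ≥ 1, let R be an orthogonal d×d real matrix, and let X = (X₁,…,X_d) be a random vector with independent coordinates having all moments up to order t finite, coordinate means μ_j = E[X_j], and satisfying E[(X_j − μ_j)^s] ≤ 2^{−s}·(s/2)^{s/2} for every j and every even s with 2 ≤ s ≤ t. Let D be the law of R·X and ν = R·μ its mean. Then for every even s ≤ t, the polynomial s^{s/2}·‖u‖^s − E_{Y∼D}[⟨Y − ν, u⟩^s] in the variables u = (u₁,…,u_d) is a sum of squares; that is, D is t-explicitly bounded with variance proxy 1. -/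
open MvPolynomial MeasureTheory Matrix

theorem IsSumSq.pow {A : Type*} [CommSemiring A] {p : A} (hp : IsSumSq p) (k : ℕ) :
    IsSumSq (p ^ k) := by
  induction k with
  | zero => simp
  | succ k ih => exact pow_succ p k ▸ ih.mul hp

section SumSq

variable {A : Type*} [CommRing A] [Algebra ℝ A]

theorem IsSumSq.real_smul {c : ℝ} (hc : 0 ≤ c) {p : A} (hp : IsSumSq p) : IsSumSq (c • p) := by
  have h : c • p = (algebraMap ℝ A √c * algebraMap ℝ A √c) * p := by
    rw [← map_mul, Real.mul_self_sqrt hc, Algebra.smul_def]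
  rw [h]
  exact (IsSumSq.mul_self _).mul hp

open scoped MatrixOrder in
theorem Matrix.PosSemidef.isSumSq_sum {ι : Type*} [Fintype ι] {M : Matrix ι ι ℝ}
    (hM : M.PosSemidef) (a : ι → A) : IsSumSq (∑ i, ∑ j, M i j • (a i * a j)) := by
  classical
  obtain ⟨B, rfl⟩ := CStarAlgebra.nonneg_iff_eq_star_mul_self.mp hM.nonneg
  have h : ∑ i, ∑ j, (star B * B) i j • (a i * a j)
      = ∑ k, (∑ i, B k i • a i) * (∑ j, B k j • a j) := by
    simp_rw [Matrix.mul_apply, Finset.sum_smul, Finset.sum_mul_sum]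
    conv_rhs => rw [Finset.sum_comm]
    refine Finset.sum_congr rfl fun i _ => ?_
    conv_rhs => rw [Finset.sum_comm]
    refine Finset.sum_congr rfl fun j _ => Finset.sum_congr rfl fun k _ => ?_
    rw [smul_mul_smul_comm]
    rfl
  rw [h]
  exact IsSumSq.sum fun k _ => IsSumSq.mul_self _

end SumSq

/-- `p` is the weak (Pettis) expectation of the vector-valued random variable `F`. -/
def HasMean {Ω E : Type*} [MeasurableSpace Ω] [AddCommGroup E] [Module ℝ E]
    (P : Measure Ω) (F : Ω → E) (p : E) : Prop :=
  ∀ φ : E →ₗ[ℝ] ℝ, Integrable (fun ω => φ (F ω)) P ∧ ∫ ω, φ (F ω) ∂P = φ p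

namespace HasMean

variable {Ω Ω' E : Type*} [MeasurableSpace Ω] [MeasurableSpace Ω'] [AddCommGroup E] [Module ℝ E]
  {P : Measure Ω} {P' : Measure Ω'} {F G : Ω → E} {p q : E}

theorem unique (hp : HasMean P F p) (hq : HasMean P F q) : p = q := by
  rw [← sub_eq_zero, ← Module.forall_dual_apply_eq_zero_iff ℝ]
  intro φ
  rw [map_sub, sub_eq_zero, ← (hp φ).2, ← (hq φ).2]

theorem add (hF : HasMean P F p) (hG : HasMean P G q) :
    HasMean P (fun ω => F ω + G ω) (p + q) := fun φ => by
  simp only [map_add]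
  exact ⟨(hF φ).1.add (hG φ).1, by rw [integral_add (hF φ).1 (hG φ).1, (hF φ).2, (hG φ).2]⟩

theorem sum {ι : Type*} (s : Finset ι) {F : ι → Ω → E} {p : ι → E}
    (h : ∀ i ∈ s, HasMean P (F i) (p i)) :
    HasMean P (fun ω => ∑ i ∈ s, F i ω) (∑ i ∈ s, p i) := fun φ => by
  simp only [map_sum]
  refine ⟨integrable_finsetSum _ fun i hi => (h i hi φ).1, ?_⟩
  rw [integral_finsetSum _ fun i hi => (h i hi φ).1]
  exact Finset.sum_congr rfl fun i hi => (h i hi φ).2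

theorem map {E' : Type*} [AddCommGroup E'] [Module ℝ E'] (T : E →ₗ[ℝ] E') (h : HasMean P F p) :
    HasMean P (fun ω => T (F ω)) (T p) := fun φ => h (φ ∘ₗ T)

theorem smul_const {f : Ω → ℝ} (hf : Integrable f P) (a : E) :
    HasMean P (fun ω => f ω • a) ((∫ ω, f ω ∂P) • a) := fun φ => by
  simp only [map_smul, smul_eq_mul]
  exact ⟨hf.mul_const _, integral_mul_const _ _⟩

theorem prod_smul [SFinite P] [SFinite P'] {f : Ω' → ℝ} (hf : Integrable f P')
    (h : HasMean P F p) :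
    HasMean (P'.prod P) (fun z => f z.1 • F z.2) ((∫ x, f x ∂P') • p) := fun φ => by
  simp only [map_smul, smul_eq_mul]
  exact ⟨hf.mul_prod (h φ).1, by rw [integral_prod_mul f (fun ω => φ (F ω)), (h φ).2]⟩

theorem comp_measurableEquiv {e : Ω' ≃ᵐ Ω} (he : MeasurePreserving e P' P) (h : HasMean P F p) :
    HasMean P' (fun ω => F (e ω)) p := fun φ =>
  ⟨(he.integrable_comp_emb e.measurableEmbedding).2 (h φ).1, by
    rw [he.integral_comp' (fun ω => φ (F ω)), (h φ).2]⟩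

variable {A : Type*} [CommRing A] [Algebra ℝ A]

theorem const_mul {F : Ω → A} {p : A} (a : A) (h : HasMean P F p) :
    HasMean P (fun ω => a * F ω) (a * p) := h.map (LinearMap.mulLeft ℝ a)

/-- The expectation of the square of a random element of a finite-dimensional subspace is a
sum of squares. -/
theorem isSumSq_of_sq [Module.Projective ℝ A] {ι : Type*} [Fintype ι] {g : ι → Ω → ℝ} {a : ι → A}
    (hg : ∀ i j, Integrable (fun ω => g i ω * g j ω) P) {p : A}
    (h : HasMean P (fun ω => (∑ i, g i ω • a i) ^ 2) p) : IsSumSq p := by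
  have h' : HasMean P (fun ω => (∑ i, g i ω • a i) ^ 2)
      (∑ i, ∑ j, (∫ ω, g i ω * g j ω ∂P) • (a i * a j)) := by
    simp_rw [sq, Finset.sum_mul_sum, smul_mul_smul_comm]
    exact HasMean.sum _ fun i _ => HasMean.sum _ fun j _ => HasMean.smul_const (hg i j) _
  rw [h.unique h']
  refine Matrix.PosSemidef.isSumSq_sum (M := Matrix.of fun i j => ∫ ω, g i ω * g j ω ∂P) ?_ a
  refine Matrix.PosSemidef.of_dotProduct_mulVec_nonneg ?_ fun x => ?_
  · ext i j
    simp [mul_comm]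
  · have hx : star x ⬝ᵥ (Matrix.of fun i j => ∫ ω, g i ω * g j ω ∂P) *ᵥ x
        = ∫ ω, (∑ i, x i * g i ω) ^ 2 ∂P := by
      have hij : ∀ i j, Integrable (fun ω => x i * g i ω * (x j * g j ω)) P := fun i j => by
        refine ((hg i j).const_mul (x i * x j)).congr (.of_forall fun ω => ?_)
        ring
      simp_rw [sq, Finset.sum_mul_sum]
      rw [integral_finsetSum _ fun i _ => integrable_finsetSum _ fun j _ => hij i j]
      refine Finset.sum_congr rfl fun i _ => ?_
      rw [integral_finsetSum _ fun j _ => hij i j, Matrix.mulVec, dotProduct, Finset.mul_sum]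
      refine Finset.sum_congr rfl fun j _ => ?_
      simp only [Matrix.of_apply, Pi.star_apply, star_trivial]
      rw [← integral_mul_const, ← integral_const_mul]
      exact integral_congr_ae (.of_forall fun ω => by ring)
    rw [hx]
    exact integral_nonneg fun ω => sq_nonneg _

end HasMean

section LinearForm

variable {A : Type*} [CommRing A] [Algebra ℝ A] {n t : ℕ} {ν : Fin n → Measure ℝ}
  [∀ j, IsProbabilityMeasure (ν j)] {f : Fin n → ℝ → ℝ}

theorem integrable_prod_comp (hf : ∀ j, ∀ k ≤ t, Integrable (fun x => f j x ^ k) (ν j))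
    {κ : Type*} [Fintype κ] (hκ : Fintype.card κ ≤ t) (β : κ → Fin n) :
    Integrable (fun ω => ∏ r, f (β r) (ω (β r))) (Measure.pi ν) := by
  classical
  have h : ∀ ω : Fin n → ℝ, ∏ r, f (β r) (ω (β r))
      = ∏ j, f j (ω j) ^ (Finset.univ.filter fun r => β r = j).card := fun ω => by
    rw [← Finset.prod_fiberwise' Finset.univ β fun j => f j (ω j)]
    simp
  simp_rw [h]
  exact Integrable.fintype_prod
    (f := fun j x => f j x ^ (Finset.univ.filter fun r => β r = j).card)
    fun j => hf j _ ((Finset.card_le_univ _).trans hκ)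

theorem sum_smul_pow (c : Fin n → ℝ) (V : Fin n → A) (k : ℕ) :
    (∑ j, c j • V j) ^ k = ∑ β : Fin k → Fin n, (∏ r, c (β r)) • ∏ r, V (β r) := by
  rw [Fintype.sum_pow]
  simp_rw [Algebra.smul_def, Finset.prod_mul_distrib, map_prod]

theorem hasMean_pow (hf : ∀ j, ∀ k ≤ t, Integrable (fun x => f j x ^ k) (ν j))
    (V : Fin n → A) {k : ℕ} (hk : k ≤ t) :
    HasMean (Measure.pi ν) (fun ω => (∑ j, f j (ω j) • V j) ^ k)
      (∑ β : Fin k → Fin n, (∫ ω, ∏ r, f (β r) (ω (β r)) ∂Measure.pi ν) • ∏ r, V (β r)) := by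
  simp_rw [sum_smul_pow]
  exact HasMean.sum _ fun β _ =>
    HasMean.smul_const (integrable_prod_comp hf (by simpa using hk) β) _

theorem HasMean.isSumSq_pow_mul_add [Module.Projective ℝ A]
    (hf : ∀ j, ∀ k ≤ t, Integrable (fun x => f j x ^ k) (ν j))
    (V : Fin n → A) {l : ℕ} (hl : 2 * l + 2 ≤ t) (y : A) {p : A}
    (h : HasMean (Measure.pi ν)
      (fun ω => ((∑ j, f j (ω j) • V j) ^ l * (∑ j, f j (ω j) • V j + y)) ^ 2) p) :
    IsSumSq p := by
  let g : (Fin (l + 1) → Fin n) ⊕ (Fin l → Fin n) → (Fin n → ℝ) → ℝ :=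
    Sum.elim (fun β ω => ∏ r, f (β r) (ω (β r))) (fun β ω => ∏ r, f (β r) (ω (β r)))
  let a : (Fin (l + 1) → Fin n) ⊕ (Fin l → Fin n) → A :=
    Sum.elim (fun β => ∏ r, V (β r)) (fun β => y * ∏ r, V (β r))
  have hga : ∀ ω : Fin n → ℝ, (∑ j, f j (ω j) • V j) ^ l * (∑ j, f j (ω j) • V j + y)
      = ∑ i, g i ω • a i := fun ω => by
    rw [mul_add, ← pow_succ, mul_comm _ y, sum_smul_pow, sum_smul_pow, Fintype.sum_sum_type,
      Finset.mul_sum]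
    simp [g, a]
  have key : ∀ {κ κ' : Type} [Fintype κ] [Fintype κ'] (β : κ → Fin n) (γ : κ' → Fin n),
      Fintype.card κ + Fintype.card κ' ≤ t →
      Integrable (fun ω => (∏ r, f (β r) (ω (β r))) * ∏ r, f (γ r) (ω (γ r)))
        (Measure.pi ν) := fun β γ hc => by
    have := integrable_prod_comp hf (by rwa [Fintype.card_sum]) (Sum.elim β γ)
    simpa only [Fintype.prod_sum_type, Sum.elim_inl, Sum.elim_inr] using this
  simp_rw [hga] at h
  refine h.isSumSq_of_sq fun i j => ?_
  rcases i with β | β <;> rcases j with γ | γ <;>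
  · simp only [g, Sum.elim_inl, Sum.elim_inr]
    exact key β γ (by simp only [Fintype.card_fin]; omega)

theorem HasMean.isSumSq_pow [Module.Projective ℝ A]
    (hf : ∀ j, ∀ k ≤ t, Integrable (fun x => f j x ^ k) (ν j))
    (V : Fin n → A) {l : ℕ} (hl : 2 * l ≤ t) {p : A}
    (h : HasMean (Measure.pi ν) (fun ω => (∑ j, f j (ω j) • V j) ^ (2 * l)) p) :
    IsSumSq p := by
  simp_rw [mul_comm 2 l, pow_mul, sum_smul_pow _ V l] at h
  refine h.isSumSq_of_sq fun β γ => ?_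
  have := integrable_prod_comp hf (by simp; omega) (Sum.elim β γ)
  simpa only [Fintype.prod_sum_type, Sum.elim_inl, Sum.elim_inr] using this

end LinearForm

section Numerics

theorem Nat.choose_succ_sq_le {s j : ℕ} (h : j + 2 ≤ s) :
    s.choose (j + 1) ^ 2 ≤ 4 * (s.choose j * s.choose (j + 2)) := by
  obtain ⟨r, rfl⟩ := Nat.exists_eq_add_of_le h
  have h1 := Nat.choose_succ_right_eq (j + 2 + r) j
  have h2 := Nat.choose_succ_right_eq (j + 2 + r) (j + 1)
  rw [show j + 2 + r - j = r + 2 by omega] at h1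
  rw [show j + 2 + r - (j + 1) = r + 1 by omega, show j + 1 + 1 = j + 2 by omega] at h2
  set a := (j + 2 + r).choose j
  set b := (j + 2 + r).choose (j + 1)
  set c := (j + 2 + r).choose (j + 2)
  refine Nat.le_of_mul_le_mul_right (c := (j + 1) * (r + 1)) ?_ (by positivity)
  calc b ^ 2 * ((j + 1) * (r + 1)) = (b * (j + 1)) * (b * (r + 1)) := by ring
    _ = a * c * ((j + 2) * (r + 2)) := by rw [h1, ← h2]; ring
    _ ≤ a * c * ((2 * (j + 1)) * (2 * (r + 1))) := by gcongr <;> omega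
    _ = 4 * (a * c) * ((j + 1) * (r + 1)) := by ring

theorem Nat.choose_mul_pow_mul_descFactorial_le {m i : ℕ} (hi : i ≤ m) :
    (2 * m).choose (2 * i) * i ^ i * (2 * (m - i)).descFactorial (m - i)
      ≤ (2 * m).descFactorial m * m.choose i := by
  obtain ⟨a, rfl⟩ := Nat.exists_eq_add_of_le hi
  rw [Nat.add_sub_cancel_left]
  have hDa := Nat.factorial_mul_descFactorial (n := 2 * a) (k := a) (by omega)
  have hDm := Nat.factorial_mul_descFactorial (n := 2 * (i + a)) (k := i + a) (by omega)
  have hC := Nat.choose_mul_factorial_mul_factorial (n := 2 * (i + a)) (k := 2 * i) (by omega)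
  have hc := Nat.choose_mul_factorial_mul_factorial (n := i + a) (k := i) (by omega)
  rw [show 2 * a - a = a by omega] at hDa
  rw [show 2 * (i + a) - (i + a) = i + a by omega] at hDm
  rw [show 2 * (i + a) - 2 * i = 2 * a by omega] at hC
  rw [show i + a - i = a by omega] at hc
  have hi' : i.factorial * i ^ i ≤ (2 * i).factorial := by
    rw [two_mul]
    exact (Nat.mul_le_mul_left _ (Nat.pow_le_pow_left (Nat.le_succ i) i)).trans
      Nat.factorial_mul_pow_le_factorial
  refine Nat.le_of_mul_le_mul_right (c := i.factorial * a.factorial) ?_ (by positivity)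
  calc _ = (2 * (i + a)).choose (2 * i) * (i.factorial * i ^ i)
        * (a.factorial * (2 * a).descFactorial a) := by ring
    _ ≤ (2 * (i + a)).choose (2 * i) * (2 * i).factorial * (2 * a).factorial := by
      rw [hDa]; gcongr
    _ = (i + a).factorial * (2 * (i + a)).descFactorial (i + a) := by rw [hC, hDm]
    _ = _ := by rw [← hc]; ring

theorem integral_pow_succ_sq_le {Ω : Type*} [MeasurableSpace Ω] {P : Measure Ω} {g : Ω → ℝ} {i : ℕ}
    (hg : ∀ k ≤ 2 * i + 2, Integrable (fun ω => g ω ^ k) P) :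
    (∫ ω, g ω ^ (2 * i + 1) ∂P) ^ 2
      ≤ (∫ ω, g ω ^ (2 * i) ∂P) * ∫ ω, g ω ^ (2 * i + 2) ∂P := by
  have h := discrim_le_zero (a := ∫ ω, g ω ^ (2 * i + 2) ∂P)
    (b := 2 * ∫ ω, g ω ^ (2 * i + 1) ∂P) (c := ∫ ω, g ω ^ (2 * i) ∂P) fun y => by
      have i₂ := (hg (2 * i + 2) (by omega)).mul_const (y * y)
      have i₁ := ((hg (2 * i + 1) (by omega)).const_mul 2).mul_const y
      have i₃ : Integrable (fun ω => g ω ^ (2 * i + 2) * (y * y) + 2 * g ω ^ (2 * i + 1) * y) P :=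
        i₂.add i₁
      rw [← integral_mul_const, ← integral_const_mul, ← integral_mul_const, ← integral_add i₂ i₁,
        ← integral_add i₃ (hg _ (by omega))]
      refine integral_nonneg fun ω => ?_
      have : g ω ^ (2 * i + 2) * (y * y) + 2 * g ω ^ (2 * i + 1) * y + g ω ^ (2 * i)
          = (g ω ^ i * (g ω * y + 1)) ^ 2 := by ring
      simp only [Pi.zero_apply, this]
      positivity
  rw [discrim] at h
  linarith

theorem Finset.sum_range_two_mul_add_one {M : Type*} [AddCommMonoid M] (F : ℕ → M) (m : ℕ) :
    ∑ i ∈ Finset.range (2 * m + 1), F i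
      = ∑ i ∈ Finset.range (m + 1), F (2 * i) + ∑ i ∈ Finset.range m, F (2 * i + 1) := by
  induction m with
  | zero => simp
  | succ m ih =>
    rw [show 2 * (m + 1) + 1 = 2 * m + 1 + 1 + 1 by ring, Finset.sum_range_succ,
      Finset.sum_range_succ, ih, Finset.sum_range_succ _ (m + 1),
      Finset.sum_range_succ (fun i => F (2 * i + 1)) m, show 2 * (m + 1) = 2 * m + 1 + 1 by ring]
    abel

end Numerics

section Recursion

variable {A : Type*} [CommRing A] [Algebra ℝ A]

theorem isSumSq_of_sq_le_four_mul {a b c : ℝ} (ha : 0 ≤ a) (hc : 0 ≤ c) (h : b ^ 2 ≤ 4 * (a * c))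
    {P₀ P₁ P₂ : A} (x : A) (h₀ : IsSumSq P₀)
    (hy : ∀ y, IsSumSq (P₂ + 2 * y * P₁ + y ^ 2 * P₀)) :
    IsSumSq (a • P₂ - b • (x * P₁) + c • (x ^ 2 * P₀)) := by
  have hx : IsSumSq (x ^ 2 * P₀) := (IsSquare.sq x).isSumSq.mul h₀
  rcases ha.eq_or_lt with rfl | ha
  · obtain rfl : b = 0 := by nlinarith
    simpa using hx.real_smul hc
  · have hcb : 0 ≤ c - b ^ 2 / (4 * a) := by
      rw [sub_nonneg, div_le_iff₀ (by positivity)]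
      linarith
    refine (congrArg IsSumSq ?_).mpr
      (((hy ((-b / (2 * a)) • x)).real_smul ha.le).add (hx.real_smul hcb))
    have e₁ : a • (2 * ((-b / (2 * a)) • x) * P₁) = -(b • (x * P₁)) := by
      rw [mul_smul_comm, smul_mul_assoc, mul_assoc, two_mul (x * P₁), smul_add, smul_add, smul_smul,
        ← add_smul, ← neg_smul]
      congr 1
      field_simp
      ring
    have e₂ : a • (((-b / (2 * a)) • x) ^ 2 * P₀) = (b ^ 2 / (4 * a)) • (x ^ 2 * P₀) := by
      rw [smul_pow, smul_mul_assoc, smul_smul]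
      congr 1
      field_simp
      ring
    rw [smul_add, smul_add, e₁, e₂, sub_smul]
    abel

/-- One step of the moment comparison: if `P k` is the `k`-th moment of a random element `Y` and
`e k` the `k`-th moment of an independent centered scalar `z`, the sum below is the moment of order
`2 * m` of `z • x + Y`. -/
theorem isSumSq_descFactorial_smul_sub {e : ℕ → ℝ} {x S : A} {P : ℕ → A} {m : ℕ}
    (he₀ : e 0 = 1) (he₁ : e 1 = 0) (he : ∀ i ≤ m, 0 ≤ e (2 * i))
    (hcs : ∀ i < m, e (2 * i + 1) ^ 2 ≤ e (2 * i) * e (2 * i + 2))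
    (hb : ∀ i, 1 ≤ i → i ≤ m → 3 * e (2 * i) ≤ (i : ℝ) ^ i)
    (hsq : ∀ l < m, ∀ y, IsSumSq (P (2 * l + 2) + 2 * y * P (2 * l + 1) + y ^ 2 * P (2 * l)))
    (hP : ∀ l ≤ m, IsSumSq (P (2 * l)))
    (hle : ∀ l ≤ m, IsSumSq (((2 * l).descFactorial l : ℝ) • S ^ l - P (2 * l))) (hS : IsSumSq S) :
    IsSumSq (((2 * m).descFactorial m : ℝ) • (x ^ 2 + S) ^ m
      - ∑ i ∈ Finset.range (2 * m + 1),
        (((2 * m).choose i : ℝ) * e i) • (x ^ i * P (2 * m - i))) := by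
  set T : ℕ → A := fun i => (((2 * m).choose i : ℝ) * e i) • (x ^ i * P (2 * m - i)) with hT
  set h : ℕ → A := fun i => if i = 0 then 0 else T (2 * i) with hh
  have hTeven : ∀ i ≤ m, IsSumSq (T (2 * i)) := fun i hi => by
    simp only [hT, pow_mul', ← Nat.mul_sub]
    exact ((IsSquare.sq (x ^ i)).isSumSq.mul (hP _ (by omega))).real_smul
      (mul_nonneg (Nat.cast_nonneg _) (he i hi))
  have hhsq : ∀ i ≤ m, IsSumSq (h i) := fun i hi => by
    by_cases h0 : i = 0
    · simp [hh, h0]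
    · simpa only [hh, h0, if_false] using hTeven i hi
  have hpair : ∀ i < m, IsSumSq (h i + h (i + 1) - T (2 * i + 1)) := fun i hi => by
    rcases Nat.eq_zero_or_pos i with rfl | hi0
    · have hT1 : T 1 = 0 := by simp [hT, he₁]
      simpa [hh, hT1] using hTeven 1 hi
    · obtain ⟨l, hl⟩ := Nat.exists_eq_add_of_lt hi
      have hchoose : (((2 * m).choose (2 * i + 1) : ℕ) : ℝ) ^ 2
          ≤ 4 * (((2 * m).choose (2 * i) : ℝ) * ((2 * m).choose (2 * i + 2) : ℝ)) := by
        exact_mod_cast Nat.choose_succ_sq_le (by omega)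
      have key := isSumSq_of_sq_le_four_mul
        (a := (2 * m).choose (2 * i) * e (2 * i))
        (b := (2 * m).choose (2 * i + 1) * e (2 * i + 1))
        (c := (2 * m).choose (2 * i + 2) * e (2 * i + 2))
        (mul_nonneg (Nat.cast_nonneg _) (he i hi.le))
        (mul_nonneg (Nat.cast_nonneg _) (he (i + 1) hi))
        (by
          have hi' := he i hi.le
          have hi'' : 0 ≤ e (2 * i + 2) := he (i + 1) hi
          calc _ = ((2 * m).choose (2 * i + 1) : ℝ) ^ 2 * e (2 * i + 1) ^ 2 := by ring
            _ ≤ (4 * (((2 * m).choose (2 * i) : ℝ) * ((2 * m).choose (2 * i + 2) : ℝ)))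
                * (e (2 * i) * e (2 * i + 2)) :=
              mul_le_mul hchoose (hcs i hi) (sq_nonneg _) (by positivity)
            _ = _ := by ring)
        x (hP l (by omega)) (hsq l (by omega))
      have key' := (IsSquare.sq (x ^ i)).isSumSq.mul key
      convert key' using 1
      have r₀ : 2 * m - 2 * i = 2 * l + 2 := by omega
      have r₁ : 2 * m - (2 * i + 1) = 2 * l + 1 := by omega
      have r₂ : 2 * m - (2 * i + 2) = 2 * l := by omega
      simp only [hh, hT, hi0.ne', Nat.succ_ne_zero, if_false, mul_one, r₀, r₁, r₂,
        mul_add, mul_sub, mul_smul_comm]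
      rw [sub_add_eq_add_sub]
      ring_nf
  have hmain : ∀ i ≤ m, IsSumSq (((2 * m).descFactorial m * m.choose i : ℝ)
      • ((x ^ 2) ^ i * S ^ (m - i)) - (T (2 * i) + 2 * h i)) := fun i hi => by
    obtain ⟨c, hc0, hc, hc'⟩ : ∃ c : ℝ, 0 ≤ c ∧ c ≤ (2 * m).choose (2 * i) * (i : ℝ) ^ i ∧
        T (2 * i) + 2 * h i = c • ((x ^ 2) ^ i * P (2 * (m - i))) := by
      rcases Nat.eq_zero_or_pos i with rfl | hi0
      · exact ⟨1, zero_le_one, by simp, by simp [hT, hh, he₀]⟩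
      · refine ⟨(2 * m).choose (2 * i) * (3 * e (2 * i)), ?_, ?_, ?_⟩
        · have := he i hi
          positivity
        · gcongr
          exact hb i hi0 hi
        · simp only [hh, hT, hi0.ne', if_false, ← pow_mul, ← Nat.mul_sub]
          rw [mul_left_comm, mul_smul (3 : ℝ), ofNat_smul_eq_nsmul, nsmul_eq_mul]
          push_cast
          ring
    have hcD : c * (2 * (m - i)).descFactorial (m - i)
        ≤ (2 * m).descFactorial m * m.choose i := by
      refine (mul_le_mul_of_nonneg_right hc (Nat.cast_nonneg _)).trans ?_
      exact_mod_cast Nat.choose_mul_pow_mul_descFactorial_le hi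
    have hx : IsSumSq ((x ^ 2) ^ i) := by
      rw [← pow_mul, mul_comm, pow_mul]
      exact (IsSquare.sq _).isSumSq
    refine (congrArg IsSumSq ?_).mpr (((hx.mul (hle (m - i) (Nat.sub_le _ _))).real_smul hc0).add
      ((hx.mul (hS.pow (m - i))).real_smul (sub_nonneg.2 hcD)))
    rw [hc', mul_sub, smul_sub, sub_smul, mul_smul_comm, smul_smul]
    abel
  have hsum := ((IsSumSq.sum (I := Finset.range (m + 1)) fun i hi =>
      hmain i (by simpa [Nat.lt_succ_iff] using hi)).add
    (IsSumSq.sum (I := Finset.range m) fun i hi => hpair i (by simpa using hi))).add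
    (hhsq m le_rfl)
  refine (congrArg IsSumSq ?_).mpr hsum
  rw [Finset.sum_range_two_mul_add_one, add_pow, Finset.smul_sum]
  have hh₀ : ∑ i ∈ Finset.range m, h (i + 1) = ∑ i ∈ Finset.range (m + 1), h i := by
    rw [Finset.sum_range_succ']
    simp [hh]
  have hexp : ∀ i, ((2 * m).descFactorial m : ℝ) • ((x ^ 2) ^ i * S ^ (m - i) * (m.choose i : A))
      = ((2 * m).descFactorial m * m.choose i : ℝ) • ((x ^ 2) ^ i * S ^ (m - i)) := fun i => by
    simp only [Algebra.smul_def, map_mul, map_natCast]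
    ring
  simp only [hexp, Finset.sum_sub_distrib, Finset.sum_add_distrib, ← Finset.mul_sum, hh₀]
  rw [Finset.sum_range_succ h]
  ring

end Recursion

theorem isSumSq_descFactorial_smul_sub_of_hasMean {A : Type*} [CommRing A] [Algebra ℝ A]
    [Module.Projective ℝ A] {n t : ℕ} {ν : Fin n → Measure ℝ} [∀ j, IsProbabilityMeasure (ν j)]
    {f : Fin n → ℝ → ℝ} (hf : ∀ j, ∀ k ≤ t, Integrable (fun x => f j x ^ k) (ν j))
    (hf₁ : ∀ j, ∫ x, f j x ∂ν j = 0)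
    (hfb : ∀ j i, 1 ≤ i → 2 * i ≤ t → 3 * ∫ x, f j x ^ (2 * i) ∂ν j ≤ (i : ℝ) ^ i)
    (V : Fin n → A) {m : ℕ} (hm : 2 * m ≤ t) {p : A}
    (hp : HasMean (Measure.pi ν) (fun ω => (∑ j, f j (ω j) • V j) ^ (2 * m)) p) :
    IsSumSq (((2 * m).descFactorial m : ℝ) • (∑ j, V j ^ 2) ^ m - p) := by
  induction n generalizing m p with
  | zero =>
    have h := hp.unique (hasMean_pow hf V hm)
    rcases Nat.eq_zero_or_pos m with rfl | hm0
    · simp [h]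
    · have : NeZero (2 * m) := ⟨by omega⟩
      simp [h, hm0.ne']
  | succ n ih =>
    set ν' : Fin n → Measure ℝ := fun j => ν j.succ
    set Y : (Fin n → ℝ) → A := fun ω => ∑ j, f j.succ (ω j) • V j.succ with hY
    have hf' : ∀ j : Fin n, ∀ k ≤ t, Integrable (fun x => f j.succ x ^ k) (ν' j) :=
      fun j => hf j.succ
    obtain ⟨P, hP⟩ : ∃ P : ℕ → A, ∀ k ≤ t, HasMean (Measure.pi ν') (fun ω => Y ω ^ k) (P k) :=
      ⟨_, fun k hk => hasMean_pow hf' (fun j => V j.succ) hk⟩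
    set e : ℕ → ℝ := fun k => ∫ x, f 0 x ^ k ∂ν 0 with he
    have hq : HasMean (Measure.pi ν) (fun ω => (∑ j, f j (ω j) • V j) ^ (2 * m))
        (∑ i ∈ Finset.range (2 * m + 1),
          (((2 * m).choose i : ℝ) * e i) • (V 0 ^ i * P (2 * m - i))) := by
      have hprod : HasMean ((ν 0).prod (Measure.pi ν'))
          (fun z => ∑ i ∈ Finset.range (2 * m + 1),
            f 0 z.1 ^ i • ((((2 * m).choose i : ℕ) : A) * V 0 ^ i * Y z.2 ^ (2 * m - i)))
          (∑ i ∈ Finset.range (2 * m + 1),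
            e i • ((((2 * m).choose i : ℕ) : A) * V 0 ^ i * P (2 * m - i))) := by
        refine HasMean.sum _ fun i hi => ?_
        have hi : i < 2 * m + 1 := by simpa using hi
        exact HasMean.prod_smul (hf 0 i (by omega)) ((hP _ (by omega)).const_mul _)
      convert hprod.comp_measurableEquiv (measurePreserving_piFinSuccAbove ν 0) using 1
      · funext ω
        rw [Fin.sum_univ_succ, add_pow]
        refine Finset.sum_congr rfl fun i _ => ?_
        rw [smul_pow, smul_mul_assoc, smul_mul_assoc]
        congr 1
        simp only [hY, MeasurableEquiv.piFinSuccAbove, Fin.insertNthEquiv, MeasurableEquiv.coe_mk,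
          Equiv.coe_fn_symm_mk, Fin.removeNth, Fin.zero_succAbove]
        ring
      · refine Finset.sum_congr rfl fun i _ => ?_
        simp only [Algebra.smul_def, map_mul, map_natCast]
        ring
    rw [hp.unique hq, Fin.sum_univ_succ]
    refine isSumSq_descFactorial_smul_sub (by simp [he]) (by simpa [he] using hf₁ 0)
      (fun i _ => ?_) (fun i hi => ?_) (fun i hi hi' => hfb 0 i hi (by omega)) (fun l hl y => ?_)
      (fun l hl => ?_) (fun l hl => ?_) ?_
    · exact integral_nonneg fun x => by simp only [pow_mul]; positivity
    · exact integral_pow_succ_sq_le fun k hk => hf 0 k (by omega)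
    · refine HasMean.isSumSq_pow_mul_add hf' (fun j => V j.succ) (l := l) (by omega) y ?_
      convert ((hP (2 * l + 2) (by omega)).add ((hP (2 * l + 1) (by omega)).const_mul (2 * y))).add
        ((hP (2 * l) (by omega)).const_mul (y ^ 2)) using 1
      funext ω
      simp only [hY]
      ring
    · exact HasMean.isSumSq_pow hf' (fun j => V j.succ) (by omega) (hP (2 * l) (by omega))
    · exact ih hf' (fun j => hf₁ j.succ) (fun j => hfb j.succ) (fun j => V j.succ) (by omega)
        (hP (2 * l) (by omega))
    · exact IsSumSq.sum fun j _ => (IsSquare.sq (V j.succ)).isSumSq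

theorem integrable_sub_const_pow {P : Measure ℝ} [IsFiniteMeasure P] {k : ℕ}
    (h : ∀ i ≤ k, Integrable (fun x : ℝ => |x| ^ i) P) (c : ℝ) :
    Integrable (fun x : ℝ => (x - c) ^ k) P := by
  simp_rw [sub_eq_add_neg, add_pow]
  refine integrable_finsetSum _ fun i hi => ((Integrable.mul_const ?_ _).mul_const _)
  refine (integrable_norm_iff (by fun_prop)).1 ?_
  simpa using h i (by simpa [Nat.lt_succ_iff] using hi)

theorem Matrix.sum_sq_sum_smul_of_transpose_mul_self {ι A : Type*} [Fintype ι] [DecidableEq ι]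
    [CommRing A] [Algebra ℝ A] {R : Matrix ι ι ℝ} (hR : Rᵀ * R = 1) (x : ι → A) :
    ∑ j, (∑ i, R i j • x i) ^ 2 = ∑ i, x i ^ 2 := by
  have hR' : R * Rᵀ = 1 := mul_eq_one_comm.1 hR
  have h : ∀ i i', ∑ j, R i j * R i' j = (1 : Matrix ι ι ℝ) i i' := fun i i' => by
    rw [← hR', Matrix.mul_apply]
    rfl
  simp_rw [sq, Finset.sum_mul_sum, smul_mul_smul_comm]
  rw [Finset.sum_comm]
  refine Finset.sum_congr rfl fun i _ => ?_
  rw [Finset.sum_comm]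
  simp_rw [← Finset.sum_smul, h, Matrix.one_apply]
  simp

/-- **Rotations of products of `t`-bounded distributions are `t`-explicitly bounded.**
Let `R` be orthogonal and let `D` be the law of `R·X` where `X` has independent coordinates
(law the product measure `Measure.pi ν`), all moments up to `t` finite, and centered `s`-th
moments at most `2^{-s}(s/2)^{s/2}` for even `2 ≤ s ≤ t`. Then for every even `s ≤ t`, the
polynomial `s^{s/2}‖u‖^s - E_{Y∼D}⟨Y - ν, u⟩^s` (expanded in the monomial basis, `ν = Rμ`
the mean) is a sum of squares. -/
theorem stmt_6 {d : ℕ} (hd : 1 ≤ d) (t : ℕ) (ht : 4 ≤ t)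
    (R : Matrix (Fin d) (Fin d) ℝ) (hR : Rᵀ * R = 1)
    (ν : Fin d → Measure ℝ) [∀ j, IsProbabilityMeasure (ν j)]
    (hint : ∀ j, ∀ s : ℕ, s ≤ t → Integrable (fun x : ℝ => |x| ^ s) (ν j))
    (μ : Fin d → ℝ) (hμ : ∀ j, μ j = ∫ x, x ∂(ν j))
    (hmom : ∀ j, ∀ s : ℕ, Even s → 2 ≤ s → s ≤ t →
      ∫ x, (x - μ j) ^ s ∂(ν j) ≤ (2 : ℝ)⁻¹ ^ s * ((s : ℝ) / 2) ^ (s / 2))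
    (D : Measure (Fin d → ℝ)) (hD : D = (Measure.pi ν).map (fun x => R.mulVec x))
    (νmean : Fin d → ℝ) (hνmean : νmean = R.mulVec μ) :
    ∀ s : ℕ, Even s → s ≤ t →
      IsSumSq (C ((s : ℝ) ^ (s / 2)) * (∑ i : Fin d, X i ^ 2) ^ (s / 2) -
        ∑ β : Fin s → Fin d,
          C (∫ y, ∏ r, (y (β r) - νmean (β r)) ∂D) * ∏ r, X (β r)) := by
  rintro s ⟨m, rfl⟩ hs
  rw [← two_mul] at hs ⊢
  rw [Nat.mul_div_cancel_left m two_pos]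
  subst hD hνmean
  have hf : ∀ j, ∀ k ≤ t, Integrable (fun x => (x - μ j) ^ k) (ν j) := fun j k hk =>
    integrable_sub_const_pow (fun i hi => hint j i (hi.trans hk)) _
  have hf₁ : ∀ j, ∫ x, (x - μ j) ∂ν j = 0 := fun j => by
    have hid : Integrable (fun x : ℝ => x) (ν j) := by
      simpa using integrable_sub_const_pow (k := 1) (fun i hi => hint j i (by omega)) 0
    rw [integral_sub hid (integrable_const _), ← hμ j]
    simp
  have hfb : ∀ j i, 1 ≤ i → 2 * i ≤ t → 3 * ∫ x, (x - μ j) ^ (2 * i) ∂ν j ≤ (i : ℝ) ^ i := by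
    intro j i hi hit
    have h := hmom j (2 * i) (even_two_mul i) (by omega) hit
    rw [Nat.mul_div_cancel_left i two_pos, Nat.cast_mul, Nat.cast_two,
      mul_div_cancel_left₀ _ (two_ne_zero' ℝ), pow_mul] at h
    have h3 : ((2 : ℝ)⁻¹ ^ 2) ^ i ≤ 1 / 3 :=
      (pow_le_of_le_one (by norm_num) (by norm_num) (by omega)).trans (by norm_num)
    have := mul_le_mul_of_nonneg_right h3 (pow_nonneg (Nat.cast_nonneg (α := ℝ) i) i)
    linarith
  set V : Fin d → MvPolynomial (Fin d) ℝ := fun j => ∑ i, R i j • X i with hV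
  have hlin : ∀ ω : Fin d → ℝ, ∑ j, (ω j - μ j) • V j
      = ∑ i, (R.mulVec ω i - R.mulVec μ i) • (X i : MvPolynomial (Fin d) ℝ) := fun ω => by
    simp_rw [hV, Finset.smul_sum, smul_smul]
    rw [Finset.sum_comm]
    refine Finset.sum_congr rfl fun i _ => ?_
    rw [← Finset.sum_smul, Matrix.mulVec, Matrix.mulVec, dotProduct, dotProduct,
      ← Finset.sum_sub_distrib]
    congr 1
    exact Finset.sum_congr rfl fun j _ => by ring
  have hmean : HasMean (Measure.pi ν) (fun ω => (∑ j, (ω j - μ j) • V j) ^ (2 * m))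
      (∑ β : Fin (2 * m) → Fin d,
        C (∫ y, ∏ r, (y (β r) - R.mulVec μ (β r)) ∂(Measure.pi ν).map (fun x => R.mulVec x))
          * ∏ r, X (β r)) := by
    simp_rw [hlin, sum_smul_pow, ← MvPolynomial.smul_eq_C_mul]
    refine HasMean.sum _ fun β _ => ?_
    have hcont : Continuous fun x : Fin d → ℝ => R.mulVec x :=
      Continuous.matrix_mulVec continuous_const continuous_id
    rw [integral_map hcont.aemeasurable (Continuous.aestronglyMeasurable (by fun_prop))]
    refine HasMean.smul_const ?_ _
    have hcoord : ∀ ω i, R.mulVec ω i - R.mulVec μ i = ∑ j, R i j * (ω j - μ j) := fun ω i => by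
      simp [Matrix.mulVec, dotProduct, mul_sub]
    simp_rw [hcoord, Finset.prod_univ_sum, Finset.prod_mul_distrib]
    exact integrable_finsetSum _ fun γ _ =>
      (integrable_prod_comp (f := fun j x => x - μ j) hf (by simpa using hs) γ).const_mul _
  have hmain := isSumSq_descFactorial_smul_sub_of_hasMean hf hf₁ hfb V hs hmean
  rw [Matrix.sum_sq_sum_smul_of_transpose_mul_self hR] at hmain
  have hD : ((2 * m).descFactorial m : ℝ) ≤ ((2 * m : ℕ) : ℝ) ^ m := by
    exact_mod_cast Nat.descFactorial_le_pow _ _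
  have hpow : IsSumSq ((∑ i : Fin d, (X i : MvPolynomial (Fin d) ℝ) ^ 2) ^ m) := by
    have hsum : IsSumSq (∑ i : Fin d, (X i : MvPolynomial (Fin d) ℝ) ^ 2) :=
      IsSumSq.sum fun i _ => (IsSquare.sq _).isSumSq
    exact hsum.pow m
  refine (congrArg IsSumSq ?_).mpr (hmain.add (hpow.real_smul (sub_nonneg.2 hD)))
  rw [← MvPolynomial.smul_eq_C_mul, sub_smul]
  abel
end

section
/- Let t ≥ 2 be even and d, n ≥ 1. For y ∈ ℝ^d let y^{⊗t/2} ∈ ℝ^{d^{t/2}} denote the vector indexed by tuples β ∈ {1,…,d}^{t/2} with entries ∏_{r=1}^{t/2} y_{β_r}. Let Y₁,…,Y_n, μ* ∈ ℝ^d and set A = (1/n)·∑_{i=1}^n (Y_i − μ*)^{⊗t/2}·((Y_i − μ*)^{⊗t/2})^⊤. Let M be a symmetric d^{t/2} × d^{t/2} real matrix such that (a) A ⪯ M + 0.1·Id in the Loewner (positive semidefinite) order, and (b) the polynomial t^{t/2}·‖v‖^t − (v^{⊗t/2})^⊤ M (v^{⊗t/2}) in the variables v = (v₁,…,v_d) is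 a sum of squares. Then 2·n·t^{t/2}·‖v‖^t − ∑_{i=1}^n ⟨Y_i − μ*, v⟩^t is a sum of squares. -/
open MvPolynomial

lemma isSumSq_C_of_nonneg {σ : Type*} {a : ℝ} (ha : 0 ≤ a) :
    IsSumSq (C a : MvPolynomial σ ℝ) := by
  rw [← Real.mul_self_sqrt ha, C_mul]
  exact .mul_self _

lemma Matrix.PosSemidef.isSumSq_quadraticForm {σ ι : Type*} [Fintype ι]
    {P : Matrix ι ι ℝ} (hP : P.PosSemidef) (w : ι → MvPolynomial σ ℝ) :
    IsSumSq (∑ β, ∑ γ, C (P β γ) * (w β * w γ)) := by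
  classical
  obtain ⟨B, rfl⟩ : ∃ B : Matrix ι ι ℝ, P = B.conjTranspose * B := by
    open scoped MatrixOrder in
    exact CStarAlgebra.nonneg_iff_eq_star_mul_self.mp hP.nonneg
  have h : ∑ β, ∑ γ, C ((B.conjTranspose * B) β γ) * (w β * w γ)
      = ∑ δ, (∑ β, C (B δ β) * w β) * ∑ γ, C (B δ γ) * w γ := by
    simp only [Finset.sum_mul_sum]
    conv_rhs => rw [Finset.sum_comm]
    refine Finset.sum_congr rfl fun β _ => ?_
    conv_rhs => rw [Finset.sum_comm]
    refine Finset.sum_congr rfl fun γ _ => ?_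
    simp only [Matrix.mul_apply, Matrix.conjTranspose_apply, star_trivial, map_sum, C_mul,
      Finset.sum_mul]
    exact Finset.sum_congr rfl fun δ _ => by ring
  rw [h]
  exact .sum fun δ _ => .mul_self _

lemma sum_sq_pow_eq_sum_prod_X {d k : ℕ} :
    (∑ j : Fin d, (X j : MvPolynomial (Fin d) ℝ) ^ 2) ^ k
      = ∑ β : Fin k → Fin d, (∏ r, X (β r)) * ∏ r, X (β r) := by
  simp only [Fintype.sum_pow, ← Finset.prod_mul_distrib, sq]

lemma linearForm_pow_eq_sum_prod_X {d k : ℕ} (y : Fin d → ℝ) :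
    (∑ j : Fin d, C (y j) * X j) ^ (k * 2)
      = ∑ β : Fin k → Fin d, ∑ γ : Fin k → Fin d,
          C ((∏ r, y (β r)) * ∏ r, y (γ r)) * ((∏ r, X (β r)) * ∏ r, X (γ r)) := by
  rw [pow_mul, Fintype.sum_pow, sq, Finset.sum_mul_sum]
  simp only [Finset.prod_mul_distrib, C_mul, map_prod]
  exact Finset.sum_congr rfl fun β _ => Finset.sum_congr rfl fun γ _ => by ring

lemma quadraticForm_decomposition {σ ι κ : Type*} [Fintype ι] [DecidableEq ι] [Fintype κ]
    {n : ℝ} (hn : n ≠ 0) (a ε : ℝ) (M : Matrix ι ι ℝ) (c : κ → ι → ℝ)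
    (w : ι → MvPolynomial σ ℝ) :
    C (2 * n * a) * (∑ β, w β * w β) - ∑ i, ∑ β, ∑ γ, C (c i β * c i γ) * (w β * w γ)
      = C n * ((∑ β, ∑ γ, C ((M + ε • (1 : Matrix ι ι ℝ)
          - Matrix.of (fun β γ => n⁻¹ * ∑ i, c i β * c i γ)) β γ) * (w β * w γ))
        + (C a * (∑ β, w β * w β) - ∑ β, ∑ γ, C (M β γ) * (w β * w γ))
        + C (a - ε) * ∑ β, w β * w β) := by
  have h_diag : ∑ β, ∑ γ, C ((ε • (1 : Matrix ι ι ℝ)) β γ) * (w β * w γ)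
      = C ε * ∑ β, w β * w β := by
    simp [Matrix.one_apply, Finset.mul_sum, apply_ite (C (σ := σ)), ite_mul]
  have h_emp : ∑ i, ∑ β, ∑ γ, C (c i β * c i γ) * (w β * w γ)
      = C n * ∑ β, ∑ γ, C (n⁻¹ * ∑ i, c i β * c i γ) * (w β * w γ) := by
    rw [Finset.sum_comm, Finset.mul_sum]
    refine Finset.sum_congr rfl fun β _ => ?_
    rw [Finset.sum_comm, Finset.mul_sum]
    refine Finset.sum_congr rfl fun γ _ => ?_
    rw [← Finset.sum_mul, ← map_sum, ← mul_assoc (C n), ← C_mul, mul_inv_cancel_left₀ hn]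
  have h_two : (C 2 : MvPolynomial σ ℝ) = 2 := map_ofNat C 2
  rw [h_emp]
  simp only [Matrix.sub_apply, Matrix.add_apply, Matrix.of_apply, C_sub, C_add, sub_mul,
    add_mul, Finset.sum_sub_distrib, Finset.sum_add_distrib, h_diag]
  rw [C_mul, C_mul, h_two]
  ring

/-- If `M` is a symmetric `d^{t/2} × d^{t/2}` matrix with
`(1/n)∑ᵢ (Yᵢ-μ*)^{⊗t/2}((Yᵢ-μ*)^{⊗t/2})ᵀ ⪯ M + 0.1·Id` and such that
`t^{t/2}‖v‖^t - (v^{⊗t/2})ᵀ M v^{⊗t/2}` is a sum of squares, then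
`2n·t^{t/2}‖v‖^t - ∑ᵢ ⟨Yᵢ-μ*, v⟩^t` is a sum of squares. -/
theorem stmt_7 {d n : ℕ} (hd : 1 ≤ d) (hn : 1 ≤ n) (t : ℕ) (ht2 : 2 ≤ t) (hte : Even t)
    (Y : Fin n → EuclideanSpace ℝ (Fin d)) (μs : EuclideanSpace ℝ (Fin d))
    (M : Matrix (Fin (t / 2) → Fin d) (Fin (t / 2) → Fin d) ℝ) (hsym : M.IsSymm)
    (hA : (M + (0.1 : ℝ) • (1 : Matrix (Fin (t / 2) → Fin d) (Fin (t / 2) → Fin d) ℝ)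
        - Matrix.of (fun β γ : Fin (t / 2) → Fin d => (n : ℝ)⁻¹ *
            ∑ i : Fin n, (∏ r, (Y i (β r) - μs (β r))) *
              ∏ r, (Y i (γ r) - μs (γ r)))).PosSemidef)
    (hM : IsSumSq (C ((t : ℝ) ^ (t / 2)) * (∑ j : Fin d, X j ^ 2) ^ (t / 2)
        - ∑ β : Fin (t / 2) → Fin d, ∑ γ : Fin (t / 2) → Fin d,
            C (M β γ) * ((∏ r, X (β r)) * ∏ r, X (γ r)))) :
    IsSumSq (C (2 * (n : ℝ) * (t : ℝ) ^ (t / 2)) * (∑ j : Fin d, X j ^ 2) ^ (t / 2)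
        - ∑ i : Fin n, (∑ j : Fin d, C (Y i j - μs j) * X j) ^ t) := by
  have hn0 : (n : ℝ) ≠ 0 := by positivity
  have htpow : (1 : ℝ) ≤ (t : ℝ) ^ (t / 2) :=
    one_le_pow₀ (by exact_mod_cast one_le_two.trans ht2)
  have hL (i : Fin n) := linearForm_pow_eq_sum_prod_X (k := t / 2) fun j => Y i j - μs j
  rw [Nat.div_mul_cancel hte.two_dvd] at hL
  simp only [hL]
  rw [sum_sq_pow_eq_sum_prod_X] at hM ⊢
  rw [quadraticForm_decomposition hn0 _ 0.1 M]
  exact (isSumSq_C_of_nonneg n.cast_nonneg).mul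
    (((hA.isSumSq_quadraticForm _).add hM).add
      ((isSumSq_C_of_nonneg (by linarith)).mul (.sum fun β _ => .mul_self _)))
end

section
/- Let t ≥ 2 be even, ε ∈ (0,1), n ∈ ℕ, X₁,…,X_n ∈ ℝ^d, μ* ∈ ℝ^d, and S_g ⊆ {1,…,n}. Let w ∈ {0,1}^n with ∑_{i=1}^n w_i ≥ (1−ε)·n, and assume that for every v ∈ ℝ^d, ∑_{i∈S_g} ⟨X_i − μ*, v⟩^t ≤ 2·n·t^{t/2}·‖v‖^t. Then for every μ ∈ ℝ^d, (∑_{i∈S_g} (1 − w_i)·⟨X_i − μ*, μ − μ*⟩)^t ≤ 2·(εn)^{t−1}·n·t^{t/2}·‖μ − μ*‖^t. -/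
open RealInnerProductSpace

/-- **Jensen's inequality** for even powers with unnormalized nonnegative weights. -/
theorem sum_mul_pow_le_sum_pow_pred_mul_sum_mul_pow_of_even {ι : Type*} (s : Finset ι)
    (a x : ι → ℝ) (ha : ∀ i ∈ s, 0 ≤ a i) {t : ℕ} (ht : t ≠ 0) (hte : Even t) :
    (∑ i ∈ s, a i * x i) ^ t ≤ (∑ i ∈ s, a i) ^ (t - 1) * ∑ i ∈ s, a i * x i ^ t := by
  rcases (Finset.sum_nonneg ha).eq_or_lt with hA | hA
  · have hzero : ∀ i ∈ s, a i = 0 := (Finset.sum_eq_zero_iff_of_nonneg ha).1 hA.symm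
    have hsum (y : ι → ℝ) : ∑ i ∈ s, a i * y i = 0 :=
      Finset.sum_eq_zero fun i hi => by rw [hzero i hi, zero_mul]
    rw [hsum, hsum, zero_pow ht, mul_zero]
  · set A := ∑ i ∈ s, a i with hAdef
    have hscale (y : ι → ℝ) : ∑ i ∈ s, a i / A * y i = (∑ i ∈ s, a i * y i) / A := by
      rw [Finset.sum_div]
      exact Finset.sum_congr rfl fun i _ => by ring
    have hJ := Real.pow_arith_mean_le_arith_mean_pow_of_even s (fun i => a i / A) x
      (fun i hi => div_nonneg (ha i hi) hA.le)
      (by rw [← Finset.sum_div, ← hAdef, div_self hA.ne']) hte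
    rw [hscale, hscale fun i => x i ^ t, div_pow, div_le_iff₀ (by positivity)] at hJ
    refine hJ.trans_eq ?_
    rw [← mul_pow_sub_one ht A]
    field_simp

/-- Bound on the error from uncorrupted samples that a Boolean weighting `w` of at least
`(1-ε)n` samples fails to select: if the good samples `S_g` have `t`-th moments about `μ*`
bounded by `2n·t^{t/2}`, then
`(∑_{i∈S_g}(1-wᵢ)⟨Xᵢ-μ*, μ-μ*⟩)^t ≤ 2(εn)^{t-1}n·t^{t/2}‖μ-μ*‖^t` for every `μ`. -/
theorem stmt_8 {n d : ℕ} (t : ℕ) (ht2 : 2 ≤ t) (hte : Even t)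
    (ε : ℝ) (hε0 : 0 < ε) (hε1 : ε < 1)
    (X : Fin n → EuclideanSpace ℝ (Fin d)) (μs : EuclideanSpace ℝ (Fin d))
    (Sg : Finset (Fin n)) (w : Fin n → ℝ) (hbool : ∀ i, w i = 0 ∨ w i = 1)
    (hsize : (1 - ε) * n ≤ ∑ i : Fin n, w i)
    (hmom : ∀ v : EuclideanSpace ℝ (Fin d),
      ∑ i ∈ Sg, ⟪X i - μs, v⟫ ^ t ≤ 2 * n * (t : ℝ) ^ (t / 2) * ‖v‖ ^ t) :
    ∀ μ : EuclideanSpace ℝ (Fin d),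
      (∑ i ∈ Sg, (1 - w i) * ⟪X i - μs, μ - μs⟫) ^ t
        ≤ 2 * (ε * n) ^ (t - 1) * n * (t : ℝ) ^ (t / 2) * ‖μ - μs‖ ^ t := by
  intro μ
  have hw0 (i : Fin n) : 0 ≤ 1 - w i := by rcases hbool i with h | h <;> simp [h]
  have hw1 (i : Fin n) : 1 - w i ≤ 1 := by rcases hbool i with h | h <;> simp [h]
  have hweight : ∑ i ∈ Sg, (1 - w i) ≤ ε * n := by
    have hle : ∑ i ∈ Sg, (1 - w i) ≤ ∑ i, (1 - w i) :=
      Finset.sum_le_univ_sum_of_nonneg hw0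
    have htotal : ∑ i, (1 - w i) = n - ∑ i, w i := by simp
    linarith
  have hmoment : ∑ i ∈ Sg, (1 - w i) * ⟪X i - μs, μ - μs⟫ ^ t
      ≤ 2 * n * (t : ℝ) ^ (t / 2) * ‖μ - μs‖ ^ t :=
    (Finset.sum_le_sum fun i _ => mul_le_of_le_one_left (hte.pow_nonneg _) (hw1 i)).trans
      (hmom _)
  calc
    _ ≤ (∑ i ∈ Sg, (1 - w i)) ^ (t - 1) *
          ∑ i ∈ Sg, (1 - w i) * ⟪X i - μs, μ - μs⟫ ^ t :=
      sum_mul_pow_le_sum_pow_pred_mul_sum_mul_pow_of_even Sg _ _ (fun i _ => hw0 i)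
        (by omega) hte
    _ ≤ (ε * n) ^ (t - 1) * (2 * n * (t : ℝ) ^ (t / 2) * ‖μ - μs‖ ^ t) :=
      mul_le_mul (pow_le_pow_left₀ (Finset.sum_nonneg fun i _ => hw0 i) hweight _) hmoment
        (Finset.sum_nonneg fun i _ => mul_nonneg (hw0 i) (hte.pow_nonneg _)) (by positivity)
    _ = _ := by ring
end

section
/- Let t ≥ 2 be even, ε ≥ 0, n ∈ ℕ, Y₁,…,Y_n ∈ ℝ^d, μ* ∈ ℝ^d, and let S_b ⊆ {1,…,n} with |S_b| ≤ ε·n. Assume that for every v ∈ ℝ^d, ∑_{i=1}^n ⟨Y_i − μ*, v⟩^t ≤ 2·n·t^{t/2}·‖v‖^t. Then for every μ ∈ ℝ^d, (∑_{i∈S_b} ⟨Y_i − μ*, μ − μ*⟩)^t ≤ 2·(εn)^{t−1}·n·t^{t/2}·‖μ − μ*‖^t. -/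
open RealInnerProductSpace

/-- Bound on the error from the original uncorrupted samples removed by the adversary:
if `|S_b| ≤ εn` and `∑ᵢ⟨Yᵢ-μ*, v⟩^t ≤ 2n·t^{t/2}‖v‖^t` for all `v`, then
`(∑_{i∈S_b}⟨Yᵢ-μ*, μ-μ*⟩)^t ≤ 2(εn)^{t-1}n·t^{t/2}‖μ-μ*‖^t` for every `μ`. -/
theorem stmt_9 {n d : ℕ} (t : ℕ) (ht2 : 2 ≤ t) (hte : Even t) (ε : ℝ) (hε : 0 ≤ ε)
    (Y : Fin n → EuclideanSpace ℝ (Fin d)) (μs : EuclideanSpace ℝ (Fin d))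
    (Sb : Finset (Fin n)) (hSb : (Sb.card : ℝ) ≤ ε * n)
    (hmom : ∀ v : EuclideanSpace ℝ (Fin d),
      ∑ i : Fin n, ⟪Y i - μs, v⟫ ^ t ≤ 2 * n * (t : ℝ) ^ (t / 2) * ‖v‖ ^ t) :
    ∀ μ : EuclideanSpace ℝ (Fin d),
      (∑ i ∈ Sb, ⟪Y i - μs, μ - μs⟫) ^ t
        ≤ 2 * (ε * n) ^ (t - 1) * n * (t : ℝ) ^ (t / 2) * ‖μ - μs‖ ^ t := by
  intro μ
  obtain ⟨k, rfl⟩ : ∃ k, t = k + 1 := ⟨t - 1, by omega⟩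
  calc (∑ i ∈ Sb, ⟪Y i - μs, μ - μs⟫) ^ (k + 1)
      = |∑ i ∈ Sb, ⟪Y i - μs, μ - μs⟫| ^ (k + 1) := (hte.pow_abs _).symm
    _ ≤ (∑ i ∈ Sb, |⟪Y i - μs, μ - μs⟫|) ^ (k + 1) := by
        gcongr
        exact Finset.abs_sum_le_sum_abs _ _
    _ ≤ (Sb.card : ℝ) ^ k * ∑ i ∈ Sb, |⟪Y i - μs, μ - μs⟫| ^ (k + 1) :=
        pow_sum_le_card_mul_sum_pow (fun _ _ ↦ abs_nonneg _) k
    _ = (Sb.card : ℝ) ^ k * ∑ i ∈ Sb, ⟪Y i - μs, μ - μs⟫ ^ (k + 1) := by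
        simp only [hte.pow_abs]
    _ ≤ (ε * n) ^ k * ∑ i : Fin n, ⟪Y i - μs, μ - μs⟫ ^ (k + 1) := by
        gcongr
        · exact Finset.sum_nonneg fun _ _ ↦ hte.pow_nonneg _
        · exact fun _ _ _ ↦ hte.pow_nonneg _
        · exact Finset.subset_univ _
    _ ≤ (ε * n) ^ k *
          (2 * n * ((k + 1 : ℕ) : ℝ) ^ ((k + 1) / 2) * ‖μ - μs‖ ^ (k + 1)) := by
        gcongr
        exact hmom _
    _ = 2 * (ε * n) ^ (k + 1 - 1) * n * ((k + 1 : ℕ) : ℝ) ^ ((k + 1) / 2) *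
          ‖μ - μs‖ ^ (k + 1) := by
        rw [Nat.add_sub_cancel]
        ring
end

section
/- Let t ≥ 2 be even, ε ≥ 0, n ∈ ℕ, X₁,…,X_n ∈ ℝ^d, μ, μ* ∈ ℝ^d, and let w ∈ {0,1}^n and S_b ⊆ {1,…,n} with ∑_{i∈S_b} w_i ≤ ε·n. Assume that for every v ∈ ℝ^d, ∑_{i=1}^n w_i·⟨X_i − μ, v⟩^t ≤ 2·t^{t/2}·n·‖v‖^t. Then (∑_{i∈S_b} w_i·⟨X_i − μ, μ − μ*⟩)^t ≤ 2·(εn)^{t−1}·n·t^{t/2}·‖μ − μ*‖^t. -/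
open RealInnerProductSpace

/-- **Jensen's inequality** for an even power, with nonnegative weights that need not sum to one. -/
theorem pow_sum_mul_le_pow_sum_mul_sum_mul_pow {ι : Type*} (s : Finset ι) (w z : ι → ℝ)
    (hw : ∀ i ∈ s, 0 ≤ w i) {t : ℕ} (ht : Even t) (ht0 : t ≠ 0) :
    (∑ i ∈ s, w i * z i) ^ t ≤ (∑ i ∈ s, w i) ^ (t - 1) * ∑ i ∈ s, w i * z i ^ t := by
  rcases (Finset.sum_nonneg hw).eq_or_lt' with hW | hW
  · have hw0 := (Finset.sum_eq_zero_iff_of_nonneg hw).1 hW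
    have hzero (f : ι → ℝ) : ∑ i ∈ s, w i * f i = 0 :=
      Finset.sum_eq_zero fun i hi => by rw [hw0 i hi, zero_mul]
    rw [hzero z, hzero fun i => z i ^ t, mul_zero, zero_pow ht0]
  · set W := ∑ i ∈ s, w i
    have hJ := Real.pow_arith_mean_le_arith_mean_pow_of_even s (fun i => w i / W) z
      (fun i hi => div_nonneg (hw i hi) hW.le)
      (by rw [← Finset.sum_div]; exact div_self hW.ne') ht
    simp only [div_mul_eq_mul_div, ← Finset.sum_div] at hJ
    rw [div_pow, div_le_div_iff₀ (by positivity) hW, ← pow_sub_one_mul ht0 W,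
      ← mul_assoc] at hJ
    rw [mul_comm (W ^ (t - 1))]
    exact le_of_mul_le_mul_right hJ hW

/-- Bound on the error from adversarially chosen samples selected by a Boolean weighting `w`:
if `∑_{i∈S_b} wᵢ ≤ εn` and the selected empirical `t`-th moments about `μ` are bounded,
`∑ᵢ wᵢ⟨Xᵢ-μ, v⟩^t ≤ 2t^{t/2}n‖v‖^t` for all `v`, then
`(∑_{i∈S_b} wᵢ⟨Xᵢ-μ, μ-μ*⟩)^t ≤ 2(εn)^{t-1}n·t^{t/2}‖μ-μ*‖^t`. -/
theorem stmt_10 {n d : ℕ} (t : ℕ) (ht2 : 2 ≤ t) (hte : Even t) (ε : ℝ) (hε : 0 ≤ ε)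
    (X : Fin n → EuclideanSpace ℝ (Fin d)) (μ μs : EuclideanSpace ℝ (Fin d))
    (w : Fin n → ℝ) (hbool : ∀ i, w i = 0 ∨ w i = 1)
    (Sb : Finset (Fin n)) (hSb : ∑ i ∈ Sb, w i ≤ ε * n)
    (hmom : ∀ v : EuclideanSpace ℝ (Fin d),
      ∑ i : Fin n, w i * ⟪X i - μ, v⟫ ^ t ≤ 2 * (t : ℝ) ^ (t / 2) * n * ‖v‖ ^ t) :
    (∑ i ∈ Sb, w i * ⟪X i - μ, μ - μs⟫) ^ t
      ≤ 2 * (ε * n) ^ (t - 1) * n * (t : ℝ) ^ (t / 2) * ‖μ - μs‖ ^ t := by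
  have hw : ∀ i, 0 ≤ w i := fun i => by rcases hbool i with h | h <;> simp [h]
  have hterm : ∀ i, 0 ≤ w i * ⟪X i - μ, μ - μs⟫ ^ t := fun i =>
    mul_nonneg (hw i) (hte.pow_nonneg _)
  calc (∑ i ∈ Sb, w i * ⟪X i - μ, μ - μs⟫) ^ t
      ≤ (∑ i ∈ Sb, w i) ^ (t - 1) * ∑ i ∈ Sb, w i * ⟪X i - μ, μ - μs⟫ ^ t :=
        pow_sum_mul_le_pow_sum_mul_sum_mul_pow Sb w _ (fun i _ => hw i) hte (by omega)
    _ ≤ (ε * n) ^ (t - 1) * (2 * (t : ℝ) ^ (t / 2) * n * ‖μ - μs‖ ^ t) := by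
        have hsum : 0 ≤ ∑ i ∈ Sb, w i := Finset.sum_nonneg fun i _ => hw i
        have hle := (Finset.sum_le_univ_sum_of_nonneg (s := Sb) hterm).trans (hmom (μ - μs))
        exact mul_le_mul (pow_le_pow_left₀ hsum hSb _) hle
          (Finset.sum_nonneg fun i _ => hterm i) (by positivity)
    _ = 2 * (ε * n) ^ (t - 1) * n * (t : ℝ) ^ (t / 2) * ‖μ - μs‖ ^ t := by ring
end

section
/- There is a universal constant C such that the following holds for every even integer t ≥ 2, every ε ∈ (0, 1/2), and every n, d ∈ ℕ. Let Y₁,…,Y_n ∈ ℝ^d and μ* ∈ ℝ^d satisfy (i) ‖(1/n)·∑_{i=1}^n Y_i − μ*‖ ≤ ε and (ii) for every v ∈ ℝ^d, ∑_{i=1}^n ⟨Y_i − μ*, v⟩^t ≤ 2·n·t^{t/2}·‖v‖^t. Then for every subset S_g ⊆ {1,…,n} with |S_g| ≥ (1−ε)·n, one has ‖(1/|S_g|)·∑_{i∈S_g} Y_i − μ*‖ ≤ C·t^{1/2}·ε^{1−1/t}. -/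
open RealInnerProductSpace

theorem Finset.abs_sum_pow_le_card_pow_mul_sum_pow {ι : Type*} (s : Finset ι) (f : ι → ℝ)
    {t : ℕ} (ht : Even t) (h0 : t ≠ 0) :
    |∑ i ∈ s, f i| ^ t ≤ (s.card : ℝ) ^ (t - 1) * ∑ i ∈ s, f i ^ t := by
  obtain ⟨m, rfl⟩ := Nat.exists_eq_succ_of_ne_zero h0
  calc |∑ i ∈ s, f i| ^ (m + 1) ≤ (∑ i ∈ s, |f i|) ^ (m + 1) := by
        gcongr
        exact Finset.abs_sum_le_sum_abs _ _
    _ ≤ (s.card : ℝ) ^ m * ∑ i ∈ s, |f i| ^ (m + 1) :=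
        pow_sum_le_card_mul_sum_pow (fun i _ => abs_nonneg (f i)) m
    _ = (s.card : ℝ) ^ (m + 1 - 1) * ∑ i ∈ s, f i ^ (m + 1) := by
        simp only [ht.pow_abs, Nat.add_sub_cancel]

theorem Real.sqrt_mul_rpow_one_sub_inv_pow {t : ℕ} (ht : Even t) (h0 : t ≠ 0) {ε : ℝ}
    (hε : 0 ≤ ε) :
    ((t : ℝ) ^ ((1 : ℝ) / 2) * ε ^ (1 - 1 / (t : ℝ))) ^ t
      = (t : ℝ) ^ (t / 2) * ε ^ (t - 1) := by
  have h1 : (t : ℝ) ≠ 0 := by exact_mod_cast h0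
  rw [mul_pow, ← Real.rpow_mul_natCast (Nat.cast_nonneg t), ← Real.rpow_mul_natCast hε,
    ← Real.rpow_natCast _ (t / 2), ← Real.rpow_natCast _ (t - 1),
    Nat.cast_div ht.two_dvd two_ne_zero, Nat.cast_sub (Nat.one_le_iff_ne_zero.2 h0)]
  congr 2
  · push_cast
    ring
  · push_cast
    field_simp

theorem Real.le_sqrt_mul_rpow_one_sub_inv {t : ℕ} (h0 : t ≠ 0) {ε : ℝ}
    (hε : 0 < ε) (hε1 : ε ≤ 1) :
    ε ≤ (t : ℝ) ^ ((1 : ℝ) / 2) * ε ^ (1 - 1 / (t : ℝ)) := by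
  have h1 : (1 : ℝ) ≤ t := by exact_mod_cast Nat.one_le_iff_ne_zero.2 h0
  have h2 : 1 ≤ (t : ℝ) ^ ((1 : ℝ) / 2) := Real.one_le_rpow h1 (by norm_num)
  have h3 : ε ≤ ε ^ (1 - 1 / (t : ℝ)) := by
    have := Real.rpow_le_rpow_of_exponent_ge hε hε1
      (show 1 - 1 / (t : ℝ) ≤ 1 by simp)
    rwa [Real.rpow_one] at this
  exact h3.trans (le_mul_of_one_le_left (by positivity) h2)

/-- Removing any `ε`-fraction of samples whose empirical mean is `ε`-close to `μ*` and whose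
empirical `t`-th moments about `μ*` are subgaussian-bounded moves the empirical mean by at
most `C√t·ε^{1-1/t}`, for a universal constant `C`. -/
theorem stmt_12 : ∃ C : ℝ, ∀ t : ℕ, Even t → 2 ≤ t → ∀ ε : ℝ, 0 < ε → ε < 1 / 2 →
    ∀ (n d : ℕ) (Y : Fin n → EuclideanSpace ℝ (Fin d)) (μs : EuclideanSpace ℝ (Fin d)),
    ‖(n : ℝ)⁻¹ • ∑ i : Fin n, Y i - μs‖ ≤ ε →
    (∀ v : EuclideanSpace ℝ (Fin d),
      ∑ i : Fin n, ⟪Y i - μs, v⟫ ^ t ≤ 2 * n * (t : ℝ) ^ (t / 2) * ‖v‖ ^ t) →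
    ∀ Sg : Finset (Fin n), (1 - ε) * n ≤ Sg.card →
    ‖((Sg.card : ℝ))⁻¹ • ∑ i ∈ Sg, Y i - μs‖
      ≤ C * (t : ℝ) ^ ((1 : ℝ) / 2) * ε ^ (1 - 1 / (t : ℝ)) := by
  refine ⟨6, fun t ht ht2 ε hε hε2 n d Y μs hmean hmom S hS => ?_⟩
  have h0 : t ≠ 0 := by omega
  have hεB := Real.le_sqrt_mul_rpow_one_sub_inv h0 hε (by linarith)
  have hBt := Real.sqrt_mul_rpow_one_sub_inv_pow ht h0 hε.le
  rw [mul_assoc]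
  set B := (t : ℝ) ^ ((1 : ℝ) / 2) * ε ^ (1 - 1 / (t : ℝ))
  rcases Nat.eq_zero_or_pos n with rfl | hn
  · have hS0 : S = ∅ := Subsingleton.elim _ _
    subst hS0
    simp at hmean ⊢
    linarith
  have hn' : (0 : ℝ) < n := by exact_mod_cast hn
  have hcard : (n : ℝ) / 2 ≤ S.card := by nlinarith
  have hc0 : (0 : ℝ) < S.card := by linarith
  set w := ((S.card : ℝ))⁻¹ • ∑ i ∈ S, Y i - μs with hw
  have hsumS : ∑ i ∈ S, (Y i - μs) = (S.card : ℝ) • w := by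
    rw [hw, smul_sub, smul_inv_smul₀ hc0.ne', Finset.sum_sub_distrib, Finset.sum_const,
      Nat.cast_smul_eq_nsmul]
  have hsum : ∑ i, (Y i - μs) = (n : ℝ) • ((n : ℝ)⁻¹ • ∑ i, Y i - μs) := by
    rw [smul_sub, smul_inv_smul₀ hn'.ne', Finset.sum_sub_distrib, Finset.sum_const,
      Finset.card_univ, Fintype.card_fin, Nat.cast_smul_eq_nsmul]
  have hall : ∑ i, ⟪Y i - μs, w⟫ ≤ n * ε * ‖w‖ := by
    rw [← sum_inner, hsum, real_inner_smul_left, mul_assoc]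
    gcongr
    exact (real_inner_le_norm _ _).trans (by gcongr)
  have hin : ∑ i ∈ S, ⟪Y i - μs, w⟫ = S.card * ‖w‖ ^ 2 := by
    rw [← sum_inner, hsumS, real_inner_smul_left, real_inner_self_eq_norm_sq]
  have hsplit := Finset.sum_add_sum_compl S fun i => ⟪Y i - μs, w⟫
  have hcompl : (Sᶜ.card : ℝ) ≤ ε * n := by
    have := Finset.card_add_card_compl S
    rw [Fintype.card_fin] at this
    have : (S.card : ℝ) + Sᶜ.card = n := by exact_mod_cast this
    linarith
  have hout : |∑ i ∈ Sᶜ, ⟪Y i - μs, w⟫| ≤ 2 * n * B * ‖w‖ := by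
    refine le_of_pow_le_pow_left₀ h0 (by positivity) ?_
    calc |∑ i ∈ Sᶜ, ⟪Y i - μs, w⟫| ^ t
        ≤ (Sᶜ.card : ℝ) ^ (t - 1) * ∑ i ∈ Sᶜ, ⟪Y i - μs, w⟫ ^ t :=
          Finset.abs_sum_pow_le_card_pow_mul_sum_pow _ _ ht h0
      _ ≤ (ε * n) ^ (t - 1) * ∑ i, ⟪Y i - μs, w⟫ ^ t := by
          gcongr
          · exact Finset.sum_nonneg fun _ _ => ht.pow_nonneg _
          · exact fun _ _ _ => ht.pow_nonneg _
          · exact Finset.subset_univ _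
      _ ≤ (ε * n) ^ (t - 1) * (2 * n * (t : ℝ) ^ (t / 2) * ‖w‖ ^ t) := by
          gcongr
          exact hmom w
      _ = 2 * n ^ t * B ^ t * ‖w‖ ^ t := by
          rw [hBt, mul_pow, ← pow_sub_one_mul h0 (n : ℝ)]
          ring
      _ ≤ 2 ^ t * n ^ t * B ^ t * ‖w‖ ^ t := by
          gcongr
          exact le_self_pow₀ one_le_two h0
      _ = (2 * n * B * ‖w‖) ^ t := by simp only [mul_pow]
  have hkey : n / 2 * ‖w‖ ^ 2 ≤ 3 * n * B * ‖w‖ := by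
    have h1 : n / 2 * ‖w‖ ^ 2 ≤ S.card * ‖w‖ ^ 2 := by gcongr
    have h2 : n * ε * ‖w‖ ≤ n * B * ‖w‖ := by gcongr
    linarith [neg_abs_le (∑ i ∈ Sᶜ, ⟪Y i - μs, w⟫)]
  rcases (norm_nonneg w).eq_or_lt with h | h
  · rw [← h]
    positivity
  · refine le_of_mul_le_mul_left ?_ (mul_pos hn' h)
    linarith
end

section
/- Let t ≥ 2 be even, n, d ∈ ℕ, X₁,…,X_n ∈ ℝ^d, S_j ⊆ {1,…,n}, w ∈ {0,1}^n, and μ, μ̄_j ∈ ℝ^d. Assume ∑_{i=1}^n w_i·⟨X_i − μ, μ − μ̄_j⟩^t ≤ 2·t^{t/2}·(∑_{i=1}^n w_i)·‖μ − μ̄_j‖^t. Then (∑_{i∈S_j} w_i·⟨μ − X_i, μ − μ̄_j⟩)^t ≤ 2·t^{t/2}·(∑_{i∈S_j} w_i)^{t−1}·(∑_{i=1}^n w_i)·‖μ − μ̄_j‖^t. -/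
open RealInnerProductSpace

/-- Hölder's inequality for weighted sums with an even exponent. -/
theorem pow_weighted_sum_le_of_even {ι : Type*} (s : Finset ι) (w z : ι → ℝ)
    (hw : ∀ i ∈ s, 0 ≤ w i) {t : ℕ} (ht : t ≠ 0) (hte : Even t) :
    (∑ i ∈ s, w i * z i) ^ t ≤ (∑ i ∈ s, w i) ^ (t - 1) * ∑ i ∈ s, w i * z i ^ t := by
  rcases (Finset.sum_nonneg hw).eq_or_lt with h | h
  · have hz := (Finset.sum_eq_zero_iff_of_nonneg hw).1 h.symm
    rw [Finset.sum_eq_zero fun i hi => by rw [hz i hi, zero_mul],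
      Finset.sum_eq_zero (f := fun i => w i * z i ^ t) fun i hi => by rw [hz i hi, zero_mul],
      zero_pow ht, mul_zero]
  · set W := ∑ i ∈ s, w i
    have key := Real.pow_arith_mean_le_arith_mean_pow_of_even s (fun i => w i / W) z
      (fun i hi => div_nonneg (hw i hi) h.le) (by rw [← Finset.sum_div, div_self h.ne']) hte
    simp_rw [div_mul_eq_mul_div, ← Finset.sum_div] at key
    rw [div_pow, div_le_div_iff₀ (pow_pos h t) h, ← pow_sub_one_mul ht W, ← mul_assoc] at key
    rw [mul_comm (W ^ (t - 1))]
    exact le_of_mul_le_mul_right key h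

/-- Bound on the error from samples selected from the wrong cluster: for Boolean `w` whose
selected empirical `t`-th moments in the direction `μ - μ̄_j` are bounded,
`(∑_{i∈S_j} wᵢ⟨μ-Xᵢ, μ-μ̄_j⟩)^t ≤ 2t^{t/2}(∑_{i∈S_j}wᵢ)^{t-1}(∑ᵢwᵢ)‖μ-μ̄_j‖^t`. -/
theorem stmt_13 {n d : ℕ} (t : ℕ) (ht2 : 2 ≤ t) (hte : Even t)
    (X : Fin n → EuclideanSpace ℝ (Fin d)) (Sj : Finset (Fin n))
    (w : Fin n → ℝ) (hbool : ∀ i, w i = 0 ∨ w i = 1)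
    (μ μj : EuclideanSpace ℝ (Fin d))
    (hmom : ∑ i : Fin n, w i * ⟪X i - μ, μ - μj⟫ ^ t
      ≤ 2 * (t : ℝ) ^ (t / 2) * (∑ i : Fin n, w i) * ‖μ - μj‖ ^ t) :
    (∑ i ∈ Sj, w i * ⟪μ - X i, μ - μj⟫) ^ t
      ≤ 2 * (t : ℝ) ^ (t / 2) * (∑ i ∈ Sj, w i) ^ (t - 1) *
          (∑ i : Fin n, w i) * ‖μ - μj‖ ^ t := by
  have hw : ∀ i, 0 ≤ w i := fun i => by rcases hbool i with h | h <;> simp [h]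
  have hflip : ∀ i, ⟪μ - X i, μ - μj⟫ ^ t = ⟪X i - μ, μ - μj⟫ ^ t := fun i => by
    rw [← neg_sub, inner_neg_left, hte.neg_pow]
  have hsub : ∑ i ∈ Sj, w i * ⟪μ - X i, μ - μj⟫ ^ t ≤ ∑ i, w i * ⟪X i - μ, μ - μj⟫ ^ t := by
    simp_rw [hflip]
    exact Finset.sum_le_sum_of_subset_of_nonneg (Finset.subset_univ _)
      fun i _ _ => mul_nonneg (hw i) (hte.pow_nonneg _)
  calc (∑ i ∈ Sj, w i * ⟪μ - X i, μ - μj⟫) ^ t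
      ≤ (∑ i ∈ Sj, w i) ^ (t - 1) * ∑ i ∈ Sj, w i * ⟪μ - X i, μ - μj⟫ ^ t :=
        pow_weighted_sum_le_of_even Sj w _ (fun i _ => hw i) (by omega) hte
    _ ≤ (∑ i ∈ Sj, w i) ^ (t - 1) *
          (2 * (t : ℝ) ^ (t / 2) * (∑ i : Fin n, w i) * ‖μ - μj‖ ^ t) :=
        mul_le_mul_of_nonneg_left (hsub.trans hmom)
          (pow_nonneg (Finset.sum_nonneg fun i _ => hw i) _)
    _ = _ := by ring
end

section
/- Let t ≥ 2 be even, n, k, d ∈ ℕ, X₁,…,X_n ∈ ℝ^d, S_j ⊆ {1,…,n}, μ, μ̄_j ∈ ℝ^d, and w ∈ {0,1}^n. Write ⟨a_j,w⟩ = ∑_{i∈S_j} w_i. Assume: (i) for every u ∈ ℝ^d, ∑_{i∈S_j} ⟨X_i − μ̄_j, u⟩^t ≤ 2·(n/k)·t^{t/2}·‖u‖^t; (ii) ∑_{i=1}^n w_i·⟨X_i − μ, μ − μ̄_j⟩^t ≤ 2·t^{t/2}·(∑_{i=1}^n w_i)·‖μ − μ̄_j‖^t; (iii) ∑_{i=1}^n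 w_i ≤ 2n/k. Then ⟨a_j,w⟩^t·‖μ − μ̄_j‖^{2t} ≤ 2^{t+3}·t^{t/2}·(n/k)·⟨a_j,w⟩^{t−1}·‖μ − μ̄_j‖^t. -/
open RealInnerProductSpace

/-- **Key identifiability inequality for mixture models (Boolean version).** For any Boolean
weight vector `w` of total weight at most `2n/k` whose empirical `t`-th moments about `μ` are
bounded in the direction `μ - μ̄_j`, and any cluster `S_j` whose samples have bounded `t`-th
moments about their empirical mean `μ̄_j`, writing `⟨a_j,w⟩ = ∑_{i∈S_j} wᵢ`,
`⟨a_j,w⟩^t‖μ-μ̄_j‖^{2t} ≤ 2^{t+3}t^{t/2}(n/k)⟨a_j,w⟩^{t-1}‖μ-μ̄_j‖^t`. -/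
theorem stmt_15 {n k d : ℕ} (t : ℕ) (ht2 : 2 ≤ t) (hte : Even t)
    (X : Fin n → EuclideanSpace ℝ (Fin d)) (Sj : Finset (Fin n))
    (μ μj : EuclideanSpace ℝ (Fin d))
    (w : Fin n → ℝ) (hbool : ∀ i, w i = 0 ∨ w i = 1)
    (h1 : ∀ u : EuclideanSpace ℝ (Fin d),
      ∑ i ∈ Sj, ⟪X i - μj, u⟫ ^ t ≤ 2 * ((n : ℝ) / k) * (t : ℝ) ^ (t / 2) * ‖u‖ ^ t)
    (h2 : ∑ i : Fin n, w i * ⟪X i - μ, μ - μj⟫ ^ t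
      ≤ 2 * (t : ℝ) ^ (t / 2) * (∑ i : Fin n, w i) * ‖μ - μj‖ ^ t)
    (h3 : ∑ i : Fin n, w i ≤ 2 * n / k) :
    (∑ i ∈ Sj, w i) ^ t * ‖μ - μj‖ ^ (2 * t)
      ≤ 2 ^ (t + 3) * (t : ℝ) ^ (t / 2) * ((n : ℝ) / k) *
          (∑ i ∈ Sj, w i) ^ (t - 1) * ‖μ - μj‖ ^ t := by
  have hw0 (i : Fin n) : 0 ≤ w i := by rcases hbool i with h | h <;> simp [h]
  have hw1 (i : Fin n) : w i ≤ 1 := by rcases hbool i with h | h <;> simp [h]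
  set v := μ - μj
  set s := ∑ i ∈ Sj, w i with hs
  have hs0 : 0 ≤ s := Finset.sum_nonneg fun i _ => hw0 i
  have hpoint (i : Fin n) :
      ‖v‖ ^ (2 * t) ≤ 2 ^ (t - 1) * (⟪X i - μj, v⟫ ^ t + ⟪X i - μ, v⟫ ^ t) := by
    have hsplit : ‖v‖ ^ 2 = ⟪X i - μj, v⟫ + -⟪X i - μ, v⟫ := by
      rw [← real_inner_self_eq_norm_sq, ← sub_eq_add_neg, ← inner_sub_left, sub_sub_sub_cancel_left]
    rw [pow_mul, hsplit, ← hte.neg_pow ⟪X i - μ, v⟫]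
    exact hte.add_pow_le
  have hA : ∑ i ∈ Sj, w i * ⟪X i - μj, v⟫ ^ t
      ≤ 2 * ((n : ℝ) / k) * (t : ℝ) ^ (t / 2) * ‖v‖ ^ t :=
    (Finset.sum_le_sum fun i _ => mul_le_of_le_one_left (hte.pow_nonneg _) (hw1 i)).trans (h1 v)
  have hB : ∑ i ∈ Sj, w i * ⟪X i - μ, v⟫ ^ t
      ≤ 2 * (t : ℝ) ^ (t / 2) * (2 * n / k) * ‖v‖ ^ t :=
    calc ∑ i ∈ Sj, w i * ⟪X i - μ, v⟫ ^ t
        ≤ ∑ i, w i * ⟪X i - μ, v⟫ ^ t :=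
          Finset.sum_le_univ_sum_of_nonneg fun i => mul_nonneg (hw0 i) (hte.pow_nonneg _)
      _ ≤ 2 * (t : ℝ) ^ (t / 2) * (∑ i, w i) * ‖v‖ ^ t := h2
      _ ≤ _ := by gcongr
  have hmain : s * ‖v‖ ^ (2 * t) ≤ 2 ^ (t + 3) * (t : ℝ) ^ (t / 2) * ((n : ℝ) / k) * ‖v‖ ^ t :=
    calc s * ‖v‖ ^ (2 * t)
        ≤ ∑ i ∈ Sj, w i * (2 ^ (t - 1) * (⟪X i - μj, v⟫ ^ t + ⟪X i - μ, v⟫ ^ t)) := by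
          rw [hs, Finset.sum_mul]
          exact Finset.sum_le_sum fun i _ => mul_le_mul_of_nonneg_left (hpoint i) (hw0 i)
      _ = 2 ^ (t - 1) * (∑ i ∈ Sj, w i * ⟪X i - μj, v⟫ ^ t
            + ∑ i ∈ Sj, w i * ⟪X i - μ, v⟫ ^ t) := by
          rw [← Finset.sum_add_distrib, Finset.mul_sum]
          exact Finset.sum_congr rfl fun i _ => by ring
      _ ≤ 2 ^ (t - 1) * (2 * ((n : ℝ) / k) * (t : ℝ) ^ (t / 2) * ‖v‖ ^ t
            + 2 * (t : ℝ) ^ (t / 2) * (2 * n / k) * ‖v‖ ^ t) := by gcongr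
      _ = 6 * (2 ^ (t - 1) * ((t : ℝ) ^ (t / 2) * ((n : ℝ) / k) * ‖v‖ ^ t)) := by ring
      _ ≤ 16 * (2 ^ (t - 1) * ((t : ℝ) ^ (t / 2) * ((n : ℝ) / k) * ‖v‖ ^ t)) := by
          gcongr; norm_num
      _ = 2 ^ (t + 3) * (t : ℝ) ^ (t / 2) * ((n : ℝ) / k) * ‖v‖ ^ t := by
          rw [show t + 3 = (t - 1) + 4 by omega, pow_add]; ring
  calc s ^ t * ‖v‖ ^ (2 * t) = s ^ (t - 1) * (s * ‖v‖ ^ (2 * t)) := by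
        rw [← mul_assoc, pow_sub_one_mul (by omega)]
    _ ≤ s ^ (t - 1) * (2 ^ (t + 3) * (t : ℝ) ^ (t / 2) * ((n : ℝ) / k) * ‖v‖ ^ t) := by gcongr
    _ = _ := by ring
end

section
/- Let n, m ∈ ℕ, let S₁,…,S_m partition {1,…,n} with |S_j| ≥ n/(2m) for every j, with 0/1 indicator vectors a₁,…,a_m ∈ ℝ^n, let v₁,…,v_n ∈ ℝ^n, and let E > 16·m. Call an index i ∈ S_j E-good if ‖v_i − a_j‖ ≤ √(n/E). Then: (a) if i, i' ∈ S_j are both E-good, then ‖v_i − v_{i'}‖ ≤ 2·√(n/E); and (b) if i ∈ S_j and i' ∈ S_{j'} with j ≠ j' are both E-good, then ‖v_i − v_{i'}‖ > 2·√(n/E). -/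
open RealInnerProductSpace

/-- Indicator vectors of disjoint finite sets are orthogonal, so the squared distance between
them is the sum of the cardinalities. -/
theorem norm_sub_sq_of_indicator_of_disjoint {ι : Type*} [Fintype ι] [DecidableEq ι]
    {s t : Finset ι} (hst : Disjoint s t) {a b : EuclideanSpace ℝ ι}
    (ha : ∀ i, a i = if i ∈ s then (1 : ℝ) else 0)
    (hb : ∀ i, b i = if i ∈ t then (1 : ℝ) else 0) :
    ‖a - b‖ ^ 2 = s.card + t.card := by
  have hcoord : ∀ i, ‖(a - b) i‖ ^ 2 =
      (if i ∈ s then (1 : ℝ) else 0) + if i ∈ t then (1 : ℝ) else 0 := by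
    intro i
    rw [PiLp.sub_apply, ha, hb]
    by_cases hs : i ∈ s
    · simp [hs, Finset.disjoint_left.mp hst hs]
    · by_cases ht : i ∈ t <;> simp [hs, ht]
  rw [EuclideanSpace.norm_sq_eq, Finset.sum_congr rfl fun i _ => hcoord i]
  simp [Finset.sum_add_distrib]

/-- **Good rows separate the clusters.** Let `S₁,…,S_m` partition `{1,…,n}` with each part
of size at least `n/(2m)`, with indicator vectors `a_j`, and let `E > 16m`. Call `i ∈ S_j`
`E`-good if `‖vᵢ - a_j‖ ≤ √(n/E)`. Then (a) good indices in the same part have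
`‖vᵢ - vᵢ'‖ ≤ 2√(n/E)`, while (b) good indices in different parts have
`‖vᵢ - vᵢ'‖ > 2√(n/E)`. -/
theorem stmt_17 {n m : ℕ} (S : Fin m → Finset (Fin n))
    (hpart : ∀ i : Fin n, ∃! j, i ∈ S j)
    (hsize : ∀ j, (n : ℝ) / (2 * m) ≤ (S j).card)
    (a : Fin m → EuclideanSpace ℝ (Fin n))
    (ha : ∀ j i, a j i = if i ∈ S j then (1 : ℝ) else 0)
    (v : Fin n → EuclideanSpace ℝ (Fin n))
    (E : ℝ) (hE : 16 * m < E) :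
    (∀ j, ∀ i ∈ S j, ∀ i' ∈ S j,
      ‖v i - a j‖ ≤ Real.sqrt (n / E) → ‖v i' - a j‖ ≤ Real.sqrt (n / E) →
      ‖v i - v i'‖ ≤ 2 * Real.sqrt (n / E))
    ∧ (∀ j j', j ≠ j' → ∀ i ∈ S j, ∀ i' ∈ S j',
      ‖v i - a j‖ ≤ Real.sqrt (n / E) → ‖v i' - a j'‖ ≤ Real.sqrt (n / E) →
      2 * Real.sqrt (n / E) < ‖v i - v i'‖) := by
  constructor
  · intro j i _ i' _ hi hi'
    calc ‖v i - v i'‖ ≤ ‖v i - a j‖ + ‖a j - v i'‖ := norm_sub_le_norm_sub_add_norm_sub _ _ _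
      _ ≤ 2 * Real.sqrt (n / E) := by rw [norm_sub_rev (a j)]; linarith
  · intro j j' hjj' i _ i' _ hi hi'
    have hn : (0 : ℝ) < n := by exact_mod_cast i.pos
    have hm : (0 : ℝ) < m := by exact_mod_cast j.pos
    have hE0 : 0 < E := by linarith
    have hdisj : Disjoint (S j) (S j') :=
      Finset.disjoint_left.mpr fun k hk hk' => hjj' ((hpart k).unique hk hk')
    have hdist := norm_sub_sq_of_indicator_of_disjoint hdisj (ha j) (ha j')
    have hsep : 16 * (n / E) < (n : ℝ) / (2 * m) + n / (2 * m) := by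
      have heq : (n : ℝ) / (2 * m) + n / (2 * m) = n / m := by field_simp; norm_num
      rw [heq, ← mul_div_assoc, div_lt_div_iff₀ hE0 hm]
      nlinarith
    have hsq : (4 * Real.sqrt (n / E)) ^ 2 < ‖a j - a j'‖ ^ 2 := by
      rw [mul_pow, Real.sq_sqrt (by positivity), hdist]
      linarith [hsize j, hsize j']
    have hlt := lt_of_pow_lt_pow_left₀ 2 (norm_nonneg _) hsq
    have htri : ‖a j - a j'‖ ≤ ‖v i - a j‖ + ‖v i - v i'‖ + ‖v i' - a j'‖ := by
      rw [norm_sub_rev (v i) (a j)]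
      calc ‖a j - a j'‖ = ‖(a j - v i) + (v i - v i') + (v i' - a j')‖ := by congr 1; abel
        _ ≤ _ := norm_add₃_le
    linarith
end

section
/- Let d ≥ 1, let t ≥ 2 be even, let μ* ∈ ℝ^d, and let Ẽ be a degree-2t pseudoexpectation in the variables μ = (μ₁,…,μ_d). Suppose Ẽ[‖μ − μ*‖^{2t}] ≤ a·Ẽ[‖μ − μ*‖^t] for some real a ≥ 0, where ‖μ − μ*‖² denotes the polynomial ∑_{r=1}^d (μ_r − μ*_r)² and ‖μ − μ*‖^t = (‖μ − μ*‖²)^{t/2}. Then Ẽ[‖μ − μ*‖^{2t}] ≤ a², and the vector Ẽ[μ] := (Ẽ[μ₁],…,Ẽ[μ_d]) satisfies ‖Ẽ[μ] − μ*‖ ≤ a^{1/t}. -/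
open MvPolynomial

section Pseudoexpectation

variable {d t : ℕ} {E : MvPolynomial (Fin d) ℝ →ₗ[ℝ] ℝ}

/-- Pseudoexpectation Cauchy–Schwarz against the constant polynomial `1`. -/
theorem sq_pseudoexpectation_le (hE1 : E 1 = 1)
    (hEpos : ∀ p : MvPolynomial (Fin d) ℝ, (p ^ 2).totalDegree ≤ 2 * t → 0 ≤ E (p ^ 2))
    {p : MvPolynomial (Fin d) ℝ} (hp : p.totalDegree ≤ t) : E p ^ 2 ≤ E (p ^ 2) := by
  have h := hEpos (p - C (E p)) <| (totalDegree_pow _ _).trans <|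
    Nat.mul_le_mul_left 2 ((totalDegree_sub_C_le p _).trans hp)
  have hexp : (p - C (E p)) ^ 2 = p ^ 2 - (2 * E p) • p + (E p ^ 2) • 1 := by
    simp only [smul_eq_C_mul, map_mul, map_pow, map_ofNat]
    ring
  rw [hexp] at h
  simp only [map_add, map_sub, map_smul, hE1, smul_eq_mul] at h
  linarith

theorem totalDegree_X_sub_C_le (r : Fin d) (c : ℝ) :
    (X r - C c : MvPolynomial (Fin d) ℝ).totalDegree ≤ 1 :=
  (totalDegree_sub_C_le _ _).trans (totalDegree_X r).le

theorem totalDegree_sum_sq_le (μs : Fin d → ℝ) :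
    (∑ r : Fin d, (X r - C (μs r)) ^ 2).totalDegree ≤ 2 :=
  totalDegree_finsetSum_le fun r _ => (totalDegree_pow _ _).trans <|
    Nat.mul_le_mul_left 2 (totalDegree_X_sub_C_le r (μs r))

theorem totalDegree_sum_sq_pow_le (μs : Fin d → ℝ) (k : ℕ) :
    ((∑ r : Fin d, (X r - C (μs r)) ^ 2) ^ k).totalDegree ≤ k * 2 :=
  (totalDegree_pow _ _).trans (Nat.mul_le_mul_left k (totalDegree_sum_sq_le μs))

/-- A power of `‖μ - μ*‖²` times a square is a sum of squares, so its pseudoexpectation is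
nonnegative. -/
theorem pseudoexpectation_sum_sq_pow_mul_sq_nonneg
    (hEpos : ∀ p : MvPolynomial (Fin d) ℝ, (p ^ 2).totalDegree ≤ 2 * t → 0 ≤ E (p ^ 2))
    (μs : Fin d → ℝ) (k : ℕ) (p : MvPolynomial (Fin d) ℝ) (hp : k + p.totalDegree ≤ t) :
    0 ≤ E ((∑ r : Fin d, (X r - C (μs r)) ^ 2) ^ k * p ^ 2) := by
  set s : MvPolynomial (Fin d) ℝ := ∑ r : Fin d, (X r - C (μs r)) ^ 2 with hs
  have hpos : ∀ q : MvPolynomial (Fin d) ℝ, q.totalDegree ≤ t → 0 ≤ E (q ^ 2) := fun q hq =>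
    hEpos q ((totalDegree_pow _ _).trans (Nat.mul_le_mul_left 2 hq))
  have hdeg : ∀ j, (s ^ j * p).totalDegree ≤ j * 2 + p.totalDegree := fun j =>
    (totalDegree_mul _ _).trans (Nat.add_le_add_right (totalDegree_sum_sq_pow_le μs j) _)
  obtain ⟨j, rfl | rfl⟩ := Nat.even_or_odd' k
  · have h : s ^ (2 * j) * p ^ 2 = (s ^ j * p) ^ 2 := by ring
    rw [h]
    exact hpos _ ((hdeg j).trans (by omega))
  · have h : s ^ (2 * j + 1) * p ^ 2
        = ∑ r : Fin d, ((X r - C (μs r)) * (s ^ j * p)) ^ 2 := by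
      simp only [mul_pow _ (s ^ j * p), ← Finset.sum_mul, ← hs]
      ring
    rw [h, map_sum]
    refine Finset.sum_nonneg fun r _ => hpos _ ((totalDegree_mul _ _).trans ?_)
    have h1 := totalDegree_X_sub_C_le r (μs r)
    have h2 := hdeg j
    omega

/-- Pseudoexpectation Jensen inequality for powers of `‖μ - μ*‖²`. -/
theorem pseudoexpectation_sum_sq_pow_le (hE1 : E 1 = 1)
    (hEpos : ∀ p : MvPolynomial (Fin d) ℝ, (p ^ 2).totalDegree ≤ 2 * t → 0 ≤ E (p ^ 2))
    (μs : Fin d → ℝ) {m : ℕ} (hm : m ≤ t) :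
    E (∑ r : Fin d, (X r - C (μs r)) ^ 2) ^ m
      ≤ E ((∑ r : Fin d, (X r - C (μs r)) ^ 2) ^ m) := by
  rcases Nat.eq_zero_or_pos m with rfl | hm0
  · simp [hE1]
  have hpos := pseudoexpectation_sum_sq_pow_mul_sq_nonneg hEpos μs
  have hdeg := totalDegree_sum_sq_le μs
  set s : MvPolynomial (Fin d) ℝ := ∑ r : Fin d, (X r - C (μs r)) ^ 2
  set c := E s
  have hc : 0 ≤ c := by
    simpa using hpos 1 1 (by rw [totalDegree_one]; omega)
  have hstep : ∀ k, k + 1 ≤ m → c * E (s ^ k) ≤ E (s ^ (k + 1)) := by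
    intro k
    induction k with
    | zero => intro _; simp [hE1, c]
    | succ k ih =>
      intro hk
      have hsq := hpos k (s - C c) (by
        have := (totalDegree_sub_C_le s c).trans hdeg
        omega)
      have hexp : s ^ k * (s - C c) ^ 2
          = s ^ (k + 1 + 1) - (2 * c) • s ^ (k + 1) + (c ^ 2) • s ^ k := by
        simp only [smul_eq_C_mul, map_mul, map_pow, map_ofNat]
        ring
      rw [hexp] at hsq
      simp only [map_add, map_sub, map_smul, smul_eq_mul] at hsq
      nlinarith [mul_le_mul_of_nonneg_left (ih (by omega)) hc]
  clear hm hm0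
  induction m with
  | zero => simp [hE1]
  | succ m ih =>
    calc c ^ (m + 1) = c * c ^ m := pow_succ' c m
      _ ≤ c * E (s ^ m) :=
        mul_le_mul_of_nonneg_left (ih fun k hk => hstep k (by omega)) hc
      _ ≤ E (s ^ (m + 1)) := hstep m le_rfl

end Pseudoexpectation

/-- **Rounding for robust mean estimation.** Let `E` be a degree-`2t` pseudoexpectation in
the variables `μ = (μ₁,…,μ_d)` (a linear functional with `E 1 = 1` and `E p² ≥ 0` whenever
`deg p² ≤ 2t`). If `E‖μ-μ*‖^{2t} ≤ a·E‖μ-μ*‖^t`, then `E‖μ-μ*‖^{2t} ≤ a²` and the vector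
of first moments satisfies `‖E[μ] - μ*‖ ≤ a^{1/t}`. -/
theorem stmt_18 {d : ℕ} (hd : 1 ≤ d) (t : ℕ) (ht2 : 2 ≤ t) (hte : Even t)
    (μs : Fin d → ℝ) (E : MvPolynomial (Fin d) ℝ →ₗ[ℝ] ℝ)
    (hE1 : E 1 = 1)
    (hEpos : ∀ p : MvPolynomial (Fin d) ℝ, (p ^ 2).totalDegree ≤ 2 * t → 0 ≤ E (p ^ 2))
    (a : ℝ) (ha : 0 ≤ a)
    (hmain : E ((∑ r : Fin d, (X r - C (μs r)) ^ 2) ^ t)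
      ≤ a * E ((∑ r : Fin d, (X r - C (μs r)) ^ 2) ^ (t / 2))) :
    E ((∑ r : Fin d, (X r - C (μs r)) ^ 2) ^ t) ≤ a ^ 2 ∧
    Real.sqrt (∑ r : Fin d, (E (X r) - μs r) ^ 2) ≤ a ^ ((1 : ℝ) / (t : ℝ)) := by
  obtain ⟨m, rfl⟩ := hte
  have hhalf : (m + m) / 2 = m := by omega
  rw [hhalf] at hmain
  have hcs := sq_pseudoexpectation_le hE1 hEpos
    ((totalDegree_sum_sq_pow_le μs m).trans (by omega))
  rw [← pow_mul, mul_two] at hcs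
  have hjensen := pseudoexpectation_sum_sq_pow_le hE1 hEpos μs (m := m) (by omega)
  have hfirst : ∑ r : Fin d, (E (X r) - μs r) ^ 2
      ≤ E (∑ r : Fin d, (X r - C (μs r)) ^ 2) := by
    rw [map_sum]
    refine Finset.sum_le_sum fun r _ => ?_
    have hlin : E (X r) - μs r = E (X r - C (μs r)) := by
      rw [map_sub, ← mul_one (C (μs r)), ← smul_eq_C_mul, map_smul, hE1, smul_eq_mul, mul_one]
    rw [hlin]
    exact sq_pseudoexpectation_le hE1 hEpos ((totalDegree_X_sub_C_le r _).trans (by omega))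
  have hS : 0 ≤ ∑ r : Fin d, (E (X r) - μs r) ^ 2 :=
    Finset.sum_nonneg fun r _ => sq_nonneg _
  have hle : E ((∑ r : Fin d, (X r - C (μs r)) ^ 2) ^ m) ≤ a := by
    by_contra! h
    nlinarith
  refine ⟨hmain.trans (by rw [sq]; exact mul_le_mul_of_nonneg_left hle ha), ?_⟩
  rw [one_div, Real.le_rpow_inv_iff_of_pos (Real.sqrt_nonneg _) ha
    (by exact_mod_cast (by omega : 0 < m + m)), Real.rpow_natCast, ← two_mul, pow_mul,
    Real.sq_sqrt hS]
  exact (pow_le_pow_left₀ hS hfirst m).trans (hjensen.trans hle)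
end
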